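/- arXiv:1010.2230 — 2 statements merged into one kernel-verified Lean document; each statement's English description precedes it below -/
import Mathlib

section
/- Let C be a class of Δ⁰₂ sets that is not Δ⁰₂ null. Then there is no A ∈ C such that for every B ∈ C, every infinite subset or cosubset of A computes an infinite subset or cosubset of B. That is, the structure {H(B) : B ∈ C} under Muchnik reducibility has no largest element. -/
/-!
Preamble: oracle computability, Turing reducibility, the jump, martingales,
and Martin-Löf randomness, developed from scratch.
-/

open scoped Classical

/-- The characteristic function of a set of naturals. -/
noncomputable def chi (A : Set ℕ) : ℕ → ℕ :=
  fun n => if n ∈ A then 1 else 0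

/-- Partial functions recursive in a (total) oracle `O : ℕ → ℕ`.
This mirrors `Nat.Partrec`, with an additional constructor for the oracle. -/
inductive RecIn (O : ℕ → ℕ) : (ℕ →. ℕ) → Prop
  | oracle : RecIn O (fun n => Part.some (O n))
  | zero : RecIn O (fun _ => Part.some 0)
  | succ : RecIn O (fun n => Part.some (n + 1))
  | left : RecIn O (fun n => Part.some (Nat.unpair n).1)
  | right : RecIn O (fun n => Part.some (Nat.unpair n).2)
  | pair {f g} : RecIn O f → RecIn O g → RecIn O (fun n => Nat.pair <$> f n <*> g n)
  | comp {f g} : RecIn O f → RecIn O g → RecIn O (fun n => g n >>= f)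
  | prec {f g} :
      RecIn O f → RecIn O g →
      RecIn O
        (Nat.unpaired fun a n =>
          n.rec (f a) fun y IH => do
            let i ← IH
            g (Nat.pair a (Nat.pair y i)))
  | rfind {f} :
      RecIn O f →
      RecIn O (fun a => Nat.rfind fun n => (fun m => m = 0) <$> f (Nat.pair a n))

/-- Codes for oracle machines. -/
inductive OCode : Type
  | zero : OCode
  | succ : OCode
  | left : OCode
  | right : OCode
  | oracle : OCode
  | pair : OCode → OCode → OCode
  | comp : OCode → OCode → OCode
  | prec : OCode → OCode → OCode
  | rfind' : OCode → OCode

/-- Evaluation of oracle codes relative to a total oracle. -/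
def evalo (O : ℕ → ℕ) : OCode → ℕ →. ℕ
  | .zero => fun _ => Part.some 0
  | .succ => fun n => Part.some (n + 1)
  | .left => fun n => Part.some (Nat.unpair n).1
  | .right => fun n => Part.some (Nat.unpair n).2
  | .oracle => fun n => Part.some (O n)
  | .pair cf cg => fun n => Nat.pair <$> evalo O cf n <*> evalo O cg n
  | .comp cf cg => fun n => evalo O cg n >>= evalo O cf
  | .prec cf cg =>
      Nat.unpaired fun a n =>
        n.rec (evalo O cf a) fun y IH => do
          let i ← IH
          evalo O cg (Nat.pair a (Nat.pair y i))
  | .rfind' cf =>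
      Nat.unpaired fun a m =>
        (Nat.rfind fun n => (fun x => x = 0) <$> evalo O cf (Nat.pair a (n + m))).map (· + m)

/-- A surjective listing of oracle codes. -/
def ofNatOCode : ℕ → OCode
  | 0 => .zero
  | 1 => .succ
  | 2 => .left
  | 3 => .right
  | 4 => .oracle
  | n + 5 =>
    have hm : n.div2.div2 < n + 5 := by
      rw [Nat.div2_val, Nat.div2_val]
      exact lt_of_le_of_lt (le_trans (Nat.div_le_self _ _) (Nat.div_le_self _ _))
        (Nat.lt_succ_of_le (Nat.le_add_right _ 4))
    have _m1 : n.div2.div2.unpair.1 < n + 5 :=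
      lt_of_le_of_lt (Nat.unpair_left_le _) hm
    have _m2 : n.div2.div2.unpair.2 < n + 5 :=
      lt_of_le_of_lt (Nat.unpair_right_le _) hm
    match n.bodd, n.div2.bodd with
    | false, false => .pair (ofNatOCode n.div2.div2.unpair.1) (ofNatOCode n.div2.div2.unpair.2)
    | false, true  => .comp (ofNatOCode n.div2.div2.unpair.1) (ofNatOCode n.div2.div2.unpair.2)
    | true , false => .prec (ofNatOCode n.div2.div2.unpair.1) (ofNatOCode n.div2.div2.unpair.2)
    | true , true  => .rfind' (ofNatOCode n.div2.div2)

/-- `Phi O e` is the `e`-th partial `O`-computable function `Φ_e^O`. -/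
def Phi (O : ℕ → ℕ) (e : ℕ) : ℕ →. ℕ := evalo O (ofNatOCode e)

/-- The Turing jump `A'` of a set `A`. -/
noncomputable def jump (A : Set ℕ) : Set ℕ := {e | (Phi (chi A) e e).Dom}

/-- The halting set `∅'`. -/
noncomputable def K : Set ℕ := jump ∅

/-- Turing reducibility between sets: `TRed B A` means `B ≤_T A`. -/
noncomputable def TRed (B A : Set ℕ) : Prop :=
  RecIn (chi A) (fun n => Part.some (chi B n))

/-- The effective join of two sets. -/
def join (A B : Set ℕ) : Set ℕ :=
  {n | (∃ a ∈ A, n = 2 * a) ∨ (∃ b ∈ B, n = 2 * b + 1)}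

/-- A set is low if its jump is Turing reducible to `∅'`. -/
noncomputable def Low (L : Set ℕ) : Prop := TRed (jump L) K

/-- The function `f : α → β` presented as an oracle on `ℕ`, via the encodings. -/
def fnOracle {α β : Type} [Encodable α] [Encodable β] (f : α → β) : ℕ → ℕ :=
  fun n => Encodable.encode ((Encodable.decode (α := α) n).map f)

/-- `FRed f A` means the function `f` is Turing reducible to the set `A`. -/
noncomputable def FRed {α β : Type} [Encodable α] [Encodable β] (f : α → β) (A : Set ℕ) : Prop :=
  RecIn (chi A) (fun n => Part.some (fnOracle f n))

/-- `FFRed g f` means the function `g` is Turing reducible to the function `f`. -/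
def FFRed {α β γ δ : Type} [Encodable α] [Encodable β] [Encodable γ] [Encodable δ]
    (g : γ → δ) (f : α → β) : Prop :=
  RecIn (fnOracle f) (fun n => Part.some (fnOracle g n))

/-- A martingale: a nonnegative rational-valued function on finite binary strings
satisfying the averaging condition `2 M(σ) = M(σ0) + M(σ1)`. -/
def IsMartingale (M : List Bool → ℚ) : Prop :=
  (∀ σ, 0 ≤ M σ) ∧ ∀ σ, 2 * M σ = M (σ ++ [false]) + M (σ ++ [true])

/-- The length-`n` initial segment of the characteristic sequence of `A`. -/
noncomputable def seg (A : Set ℕ) (n : ℕ) : List Bool :=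
  (List.range n).map fun i => if i ∈ A then true else false

/-- A martingale succeeds on a set `A` if `limsup_n M(A↾n) = ∞`. -/
noncomputable def Succeeds (M : List Bool → ℚ) (A : Set ℕ) : Prop :=
  ∀ q : ℚ, ∃ n, q < M (seg A n)

/-- `H(A)`: the mass problem of infinite subsets or cosubsets of `A`. -/
def Hset (A : Set ℕ) : Set (Set ℕ) :=
  {S | S.Infinite ∧ (S ⊆ A ∨ S ⊆ Aᶜ)}

/-- Muchnik reducibility: `MuchnikLe P Q` iff every member of `Q` computes a member of `P`. -/
noncomputable def MuchnikLe (P Q : Set (Set ℕ)) : Prop :=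
  ∀ B ∈ Q, ∃ A ∈ P, TRed A B

/-- A set of naturals is computably enumerable. -/
def CE (W : Set ℕ) : Prop :=
  ∃ g : ℕ →. ℕ, RecIn (fun _ => 0) g ∧ ∀ n, n ∈ W ↔ (g n).Dom

/-- A Martin-Löf test: a uniformly c.e. sequence of sets of strings `U n`,
with the open set generated by `U n` having measure at most `2^{-n}`. -/
def MLTest (U : ℕ → Set (List Bool)) : Prop :=
  CE {p : ℕ | ∃ σ ∈ U (Nat.unpair p).1, (Nat.unpair p).2 = Encodable.encode σ} ∧
  ∀ n, (∑' σ : (U n), ((1 : ENNReal) / 2) ^ (σ : List Bool).length) ≤ (1 / 2) ^ n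

/-- A set is 1-random (Martin-Löf random) if for every Martin-Löf test there is
an `n` such that no initial segment of the set lies in `U n`. -/
noncomputable def MLRandom (A : Set ℕ) : Prop :=
  ∀ U : ℕ → Set (List Bool), MLTest U → ∃ n, ∀ m, seg A m ∉ U n


section
open scoped Classical
open Encodable

namespace S10

theorem RecIn.of_eq {O : ℕ → ℕ} {f g : ℕ →. ℕ} (hf : RecIn O f) (h : ∀ n, f n = g n) : RecIn O g := by
  have : f = g := funext h
  exact this ▸ hf

theorem RecIn.of_partrec {O : ℕ → ℕ} {f : ℕ →. ℕ} (hf : Nat.Partrec f) : RecIn O f := by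
  induction hf with
  | zero => exact RecIn.zero
  | succ => exact RecIn.succ
  | left => exact RecIn.left
  | right => exact RecIn.right
  | pair _ _ h1 h2 => exact RecIn.pair h1 h2
  | comp _ _ h1 h2 => exact RecIn.comp h1 h2
  | prec _ _ h1 h2 => exact RecIn.prec h1 h2
  | rfind _ h1 => exact RecIn.rfind h1

/-- total functions recursive in an oracle -/
def RT (O : ℕ → ℕ) (f : ℕ → ℕ) : Prop := RecIn O (fun n => Part.some (f n))

theorem RT.of_primrec {O f} (hf : Nat.Primrec f) : RT O f :=
  RecIn.of_partrec (Nat.Partrec.of_primrec hf)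

theorem RT.of_computable {O} {f : ℕ → ℕ} (hf : Computable f) : RT O f :=
  RecIn.of_partrec (Partrec.nat_iff.1 hf)

theorem RT.comp {O f g} (hf : RT O f) (hg : RT O g) : RT O (fun n => f (g n)) :=
  RecIn.of_eq (RecIn.comp hf hg) (fun n => by simp)

theorem RT.pair {O f g} (hf : RT O f) (hg : RT O g) : RT O (fun n => Nat.pair (f n) (g n)) :=
  RecIn.of_eq (RecIn.pair hf hg) (fun n => by simp [Seq.seq])

theorem RT.comp₂ {O f g} {F : ℕ → ℕ → ℕ} (hF : Primrec₂ F) (hf : RT O f) (hg : RT O g) :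
    RT O (fun n => F (f n) (g n)) := by
  have h1 : RT O (fun p => F p.unpair.1 p.unpair.2) :=
    RT.of_computable (hF.comp (Primrec.fst.comp Primrec.unpair) (Primrec.snd.comp Primrec.unpair)).to_comp
  have := RT.comp h1 (RT.pair hf hg)
  simpa using this

section
variable {α β γ : Type} [Primcodable α] [Primcodable β] [Primcodable γ]

/-- typed relative computability -/
def RC (O : ℕ → ℕ) (f : α → β) : Prop := ∃ r, RT O r ∧ ∀ a, r (encode a) = encode (f a)

theorem RC.of_computable {O} {f : α → β} (hf : Computable f) : RC O f := by
  refine ⟨fun n => (encode ((decode n : Option α).map f)) - 1, ?_, ?_⟩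
  · apply RT.of_computable
    have : Computable (fun n => ((decode n : Option α).map f)) :=
      Computable.option_map Computable.decode (hf.comp Computable.snd)
    exact Computable.pred.comp (Computable.encode.comp this)
  · intro a; simp

theorem RC.of_primrec {O} {f : α → β} (hf : Primrec f) : RC O f := RC.of_computable hf.to_comp

theorem RC.comp {O} {f : β → γ} {g : α → β} (hf : RC O f) (hg : RC O g) : RC O (fun a => f (g a)) := by
  obtain ⟨r, hr, h⟩ := hf
  obtain ⟨s, hs, h'⟩ := hg
  exact ⟨_, hr.comp hs, fun a => by simp [h, h']⟩

theorem RC.pair {O} {f : α → β} {g : α → γ} (hf : RC O f) (hg : RC O g) : RC O (fun a => (f a, g a)) := by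
  obtain ⟨r, hr, h⟩ := hf
  obtain ⟨s, hs, h'⟩ := hg
  exact ⟨_, hr.pair hs, fun a => by simp [h, h']⟩

theorem RC.of_eq {O} {f g : α → β} (hf : RC O f) (h : ∀ a, f a = g a) : RC O g := by
  have : f = g := funext h
  exact this ▸ hf

theorem RC.iterate {O} {f : β → β} (hf : RC O f) : RC O (fun p : β × ℕ => f^[p.2] p.1) := by
  obtain ⟨r, hr, h⟩ := hf
  refine ⟨fun p => r^[p.unpair.2] p.unpair.1, ?_, ?_⟩
  · have h1 : RecIn O (fun n => Part.some n) :=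
      RT.of_primrec Nat.Primrec.id
    have h2 : RT O (fun n => r (n.unpair.2.unpair.2)) :=
      hr.comp (RT.comp (RT.of_primrec Nat.Primrec.right) (RT.of_primrec Nat.Primrec.right))
    refine RecIn.of_eq (RecIn.prec h1 h2) (fun n => ?_)
    simp only [Nat.unpaired, Nat.unpair_pair]
    induction n.unpair.2 with
    | zero => simp
    | succ k ih => 
      simp only [ih]
      simp [Function.iterate_succ_apply']
  · rintro ⟨b, n⟩
    simp
    induction n with
    | zero => simp
    | succ k ih => simp [Function.iterate_succ_apply', ih, h]

theorem RC.fnOracle {O} {f : α → β} (hf : RC O f) : RT O (fnOracle f) := by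
  obtain ⟨r, hr, h⟩ := hf
  have h1 : RT O (fun n => encode (decode n : Option α)) :=
    RT.of_computable (Computable.encode.comp Computable.decode)
  have h2 : RT O (fun n => r (encode (decode n : Option α) - 1)) :=
    RT.comp hr (RT.comp (RT.of_computable Computable.pred) h1)
  have hF : Primrec₂ (fun u v : ℕ => if u = 0 then 0 else v + 1) :=
    Primrec.ite (Primrec.eq.comp Primrec.fst (Primrec.const 0)) (Primrec.const 0)
      (Primrec.succ.comp Primrec.snd)
  refine RecIn.of_eq (RT.comp₂ hF h1 h2) (fun n => ?_)
  unfold _root_.fnOracle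
  cases hd : (decode n : Option α) with
  | none => simp [hd]
  | some a => simp [hd, h]

theorem RC.find {O} {p : α × ℕ → Bool} (hp : RC O p) (hex : ∀ a, ∃ n, p (a, n) = true) :
    RC O (fun a => Nat.find (hex a)) := by
  have h0 := hp.fnOracle
  have hF : Computable (fun u : ℕ => if u = 1 then 1 else 0) :=
    (Primrec.ite (Primrec.eq.comp Primrec.id (Primrec.const 1)) (Primrec.const 1)
      (Primrec.const 0)).to_comp
  have h1 := (RT.comp (RT.of_computable hF) h0)
  have key : ∀ a n : ℕ, (if _root_.fnOracle p (Nat.pair a n) = 1 then 1 else 0 : ℕ) = 0 ↔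
      ∀ x : α, (decode a : Option α) = some x → p (x, n) = true := by
    intro a n
    unfold _root_.fnOracle
    cases hd : (decode a : Option α) with
    | none => simp [Encodable.decode_prod_val, hd]
    | some x => 
      cases hpx : p (x, n) <;> simp [Encodable.decode_prod_val, hd, hpx]
  have hex' : ∀ a : ℕ, ∃ n, ∀ x : α, (decode a : Option α) = some x → p (x, n) = true := by
    intro a
    cases hd : (decode a : Option α) with
    | none => simp
    | some x => 
      obtain ⟨n, hn⟩ := hex x
      exact ⟨n, by rintro y ⟨⟩; exact hn⟩
  refine ⟨fun a => Nat.find (hex' a), ?_, ?_⟩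
  · refine RecIn.of_eq (RecIn.rfind h1) (fun a => ?_)
    refine Part.eq_some_iff.2 (Nat.mem_rfind.2 ⟨?_, ?_⟩)
    · have := (key a _).2 (Nat.find_spec (hex' a))
      simp [this]
    · intro m hm
      have := Nat.find_min (hex' a) hm
      rw [← key] at this
      simp only [Part.map_eq_map, Part.map_some, Part.mem_some_iff]
      symm; exact decide_eq_false this
  · intro a
    simp

end
end S10

end


section
open scoped Classical
open Encodable

namespace S10

theorem seg_length (A : Set ℕ) (n : ℕ) : (seg A n).length = n := by simp [seg]

theorem seg_getElem? (A : Set ℕ) (n x : ℕ) : (seg A n)[x]? = if x < n then some (decide (x ∈ A)) else none := by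
  unfold seg
  by_cases h : x < n
  · simp [h]
  · simp [h]

theorem seg_prefix (A : Set ℕ) {n m : ℕ} (h : n ≤ m) : seg A n <+: seg A m := by
  rw [List.prefix_iff_getElem?]
  intro i hi
  have hi' : i < n := by simpa [seg_length] using hi
  rw [seg_getElem?, if_pos (lt_of_lt_of_le hi' h)]
  have := seg_getElem? A n i
  rw [if_pos hi', List.getElem?_eq_getElem hi] at this
  exact this.symm

theorem getElem?_of_prefix {α : Type} {σ τ : List α} (h : σ <+: τ) {x : ℕ} {b : α} (hx : σ[x]? = some b) :
    τ[x]? = some b := by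
  obtain ⟨ρ, rfl⟩ := h
  rw [List.getElem?_append_left]
  · exact hx
  · exact (List.getElem?_eq_some_iff.1 hx).1

/-- normal form data -/
def NF (S : Set ℕ) (f : ℕ →. ℕ) : Prop :=
  ∃ F : List Bool → ℕ → Option ℕ, Primrec₂ F ∧
    (∀ σ τ n y, σ <+: τ → F σ n = some y → F τ n = some y) ∧
    ∀ n y, y ∈ f n ↔ ∃ k, F (seg S k) n = some y

theorem NF.of_total {S : Set ℕ} {f : ℕ → ℕ} (hf : Primrec f) : NF S (fun n => Part.some (f n)) := by
  refine ⟨fun _ n => some (f n), Primrec.option_some.comp (hf.comp Primrec.snd), ?_, ?_⟩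
  · intro _ _ _ _ _ h; exact h
  · intro n y; simp [eq_comm]

theorem NF.oracle (S : Set ℕ) : NF S (fun n => Part.some (chi S n)) := by
  refine ⟨fun σ n => (σ[n]?).map (fun b => cond b 1 0), ?_, ?_, ?_⟩
  · exact Primrec.option_map Primrec.list_getElem? ((Primrec.dom_bool (fun b => cond b 1 0)).comp Primrec.snd)
  · intro σ τ n y h h1
    simp only [Option.map_eq_some_iff] at h1 ⊢
    obtain ⟨b, hb, hy⟩ := h1
    exact ⟨b, getElem?_of_prefix h hb, hy⟩
  · intro n y
    simp only [seg_getElem?, Part.mem_some_iff, Option.map_eq_some_iff]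
    constructor
    · rintro rfl
      refine ⟨n+1, decide (n ∈ S), by simp, ?_⟩
      by_cases h : n ∈ S <;> simp [chi, h]
    · rintro ⟨k, b, hb, rfl⟩
      split_ifs at hb
      cases hb
      by_cases h : n ∈ S <;> simp [chi, h]

theorem NF.pair {S : Set ℕ} {f g : ℕ →. ℕ} (hf : NF S f) (hg : NF S g) :
    NF S (fun n => Nat.pair <$> f n <*> g n) := by
  obtain ⟨F, pF, mF, hF⟩ := hf
  obtain ⟨G, pG, mG, hG⟩ := hg
  refine ⟨fun σ n => (F σ n).bind fun a => (G σ n).map fun b => Nat.pair a b, ?_, ?_, ?_⟩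
  · refine Primrec.option_bind pF (Primrec.option_map (pG.comp (Primrec.fst.comp Primrec.fst) (Primrec.snd.comp Primrec.fst)) ?_)
    exact Primrec₂.natPair.comp (Primrec.snd.comp Primrec.fst) Primrec.snd
  · intro σ τ n y h
    simp only [Option.bind_eq_some_iff, Option.map_eq_some_iff]
    rintro ⟨a, ha, b, hb, rfl⟩
    exact ⟨a, mF _ _ _ _ h ha, b, mG _ _ _ _ h hb, rfl⟩
  · intro n y
    simp only [Option.bind_eq_some_iff, Option.map_eq_some_iff, Seq.seq, Part.map_eq_map, Part.mem_bind_iff, Part.mem_map_iff]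
    constructor
    · rintro ⟨_, ⟨a, ha, rfl⟩, b, hb, rfl⟩
      obtain ⟨k, hk⟩ := (hF _ _).1 ha
      obtain ⟨l, hl⟩ := (hG _ _).1 hb
      exact ⟨max k l, a, mF _ _ _ _ (seg_prefix S (le_max_left _ _)) hk, b,
        mG _ _ _ _ (seg_prefix S (le_max_right _ _)) hl, rfl⟩
    · rintro ⟨k, a, ha, b, hb, rfl⟩
      exact ⟨_, ⟨a, (hF _ _).2 ⟨k, ha⟩, rfl⟩, b, (hG _ _).2 ⟨k, hb⟩, rfl⟩

theorem NF.comp {S : Set ℕ} {f g : ℕ →. ℕ} (hf : NF S f) (hg : NF S g) :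
    NF S (fun n => g n >>= f) := by
  obtain ⟨F, pF, mF, hF⟩ := hf
  obtain ⟨G, pG, mG, hG⟩ := hg
  refine ⟨fun σ n => (G σ n).bind fun a => F σ a, ?_, ?_, ?_⟩
  · exact Primrec.option_bind pG (pF.comp (Primrec.fst.comp Primrec.fst) Primrec.snd)
  · intro σ τ n y h
    simp only [Option.bind_eq_some_iff]
    rintro ⟨a, ha, hb⟩
    exact ⟨a, mG _ _ _ _ h ha, mF _ _ _ _ h hb⟩
  · intro n y
    refine Part.mem_bind_iff.trans ?_
    simp only [Option.bind_eq_some_iff]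
    constructor
    · rintro ⟨a, ha, hb⟩
      obtain ⟨k, hk⟩ := (hG _ _).1 ha
      obtain ⟨l, hl⟩ := (hF _ _).1 hb
      exact ⟨max k l, a, mG _ _ _ _ (seg_prefix S (le_max_left _ _)) hk,
        mF _ _ _ _ (seg_prefix S (le_max_right _ _)) hl⟩
    · rintro ⟨k, a, ha, hb⟩
      exact ⟨a, (hG _ _).2 ⟨k, ha⟩, (hF _ _).2 ⟨k, hb⟩⟩

theorem NF.prec {S : Set ℕ} {f g : ℕ →. ℕ} (hf : NF S f) (hg : NF S g) :
    NF S (Nat.unpaired fun a n =>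
          n.rec (f a) fun y IH => do
            let i ← IH
            g (Nat.pair a (Nat.pair y i))) := by
  obtain ⟨F, pF, mF, hF⟩ := hf
  obtain ⟨G, pG, mG, hG⟩ := hg
  refine ⟨fun σ n => n.unpair.2.rec (F σ n.unpair.1) fun y IH => IH.bind fun i =>
    G σ (Nat.pair n.unpair.1 (Nat.pair y i)), ?_, ?_, ?_⟩
  · refine Primrec.nat_rec' (α := List Bool × ℕ) (β := Option ℕ)
      (h := fun q r => r.2.bind fun i => G q.1 (Nat.pair q.2.unpair.1 (Nat.pair r.1 i))) (Primrec.snd.comp (Primrec.unpair.comp Primrec.snd))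
      (pF.comp Primrec.fst (Primrec.fst.comp (Primrec.unpair.comp Primrec.snd))) ?_
    refine Primrec.option_bind (Primrec.snd.comp Primrec.snd) ?_
    refine pG.comp (Primrec.fst.comp (Primrec.fst.comp Primrec.fst)) ?_
    refine Primrec₂.natPair.comp (Primrec.fst.comp (Primrec.unpair.comp (Primrec.snd.comp (Primrec.fst.comp Primrec.fst)))) ?_
    exact Primrec₂.natPair.comp (Primrec.fst.comp (Primrec.snd.comp Primrec.fst)) Primrec.snd
  · intro σ τ n y h
    beta_reduce
    generalize n.unpair.2 = k
    generalize n.unpair.1 = a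
    induction k generalizing y with
    | zero => exact mF _ _ _ _ h
    | succ k ih =>
      simp only [Option.bind_eq_some_iff]
      rintro ⟨i, hi, hb⟩
      exact ⟨i, ih _ hi, mG _ _ _ _ h hb⟩
  · intro n y
    simp only [Nat.unpaired]
    generalize n.unpair.2 = k
    generalize n.unpair.1 = a
    have mono : ∀ (k : ℕ) (σ τ : List Bool) (y : ℕ), σ <+: τ → (k.rec (F σ a) (fun y IH => IH.bind fun i =>
      G σ (Nat.pair a (Nat.pair y i))) : Option ℕ) = some y → (k.rec (F τ a) (fun y IH => IH.bind fun i =>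
      G τ (Nat.pair a (Nat.pair y i))) : Option ℕ) = some y := by
      intro k σ τ y h
      induction k generalizing y with
      | zero => exact mF _ _ _ _ h
      | succ k ih =>
        simp only [Option.bind_eq_some_iff]
        rintro ⟨i, hi, hb⟩
        exact ⟨i, ih _ hi, mG _ _ _ _ h hb⟩
    induction k generalizing y with
    | zero => exact hF _ _
    | succ k ih =>
      simp only [Option.bind_eq_some_iff, Part.bind_eq_bind, Part.mem_bind_iff]
      constructor
      · rintro ⟨i, hi, hb⟩
        obtain ⟨u, hu⟩ := (ih _).1 hi
        obtain ⟨l, hl⟩ := (hG _ _).1 hb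
        exact ⟨max u l, i, mono _ _ _ _ (seg_prefix S (le_max_left _ _)) hu,
          mG _ _ _ _ (seg_prefix S (le_max_right _ _)) hl⟩
      · rintro ⟨u, i, hi, hb⟩
        exact ⟨i, (ih _).2 ⟨u, hi⟩, (hG _ _).2 ⟨u, hb⟩⟩

theorem NF.rfind {S : Set ℕ} {f : ℕ →. ℕ} (hf : NF S f) :
    NF S (fun a => Nat.rfind fun n => (fun m => m = 0) <$> f (Nat.pair a n)) := by
  obtain ⟨F, pF, mF, hF⟩ := hf
  let p : List Bool → ℕ → ℕ → Bool := fun σ a n => (F σ (Nat.pair a n)).elim true (fun v => v == 0)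
  let ix : List Bool → ℕ → ℕ := fun σ a => (List.range σ.length).findIdx (p σ a)
  let R : List Bool → ℕ → Option ℕ := fun σ a => if F σ (Nat.pair a (ix σ a)) = some 0 then some (ix σ a) else none
  have spec : ∀ σ a n, R σ a = some n ↔ n ≤ σ.length ∧ F σ (Nat.pair a n) = some 0 ∧
      ∀ j < n, ∃ v, v ≠ 0 ∧ F σ (Nat.pair a j) = some v := by
    intro σ a n
    have hp : ∀ j, p σ a j = false ↔ ∃ v, v ≠ 0 ∧ F σ (Nat.pair a j) = some v := by
      intro j
      simp only [p]
      cases F σ (Nat.pair a j) <;> simp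
    have hlen : ix σ a ≤ σ.length := by
      have := List.findIdx_le_length (xs := List.range σ.length) (p := p σ a)
      simpa [ix] using this
    have hlt : ∀ j < ix σ a, p σ a j = false := by
      intro j hj
      have := List.not_of_lt_findIdx hj
      simpa using this
    constructor
    · intro h
      simp only [R] at h
      split_ifs at h with h0
      cases h
      exact ⟨hlen, h0, fun j hj => (hp j).1 (hlt j hj)⟩
    · rintro ⟨hn, h0, hj⟩
      have : ix σ a = n := by
        rcases lt_trichotomy (ix σ a) n with h | h | h
        · exfalso
          have h1 := (hp _).2 (hj _ h)
          have h2 : ix σ a < (List.range σ.length).length := by simp; omega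
          have h3 := List.findIdx_getElem (w := h2)
          simp only [List.getElem_range] at h3
          change p σ a (ix σ a) = true at h3
          rw [h1] at h3; cases h3
        · exact h
        · exfalso
          have := hlt n h
          simp [p, h0] at this
      simp [R, this, h0]
  have pR : Primrec₂ R := by
    have hp : Primrec₂ (fun (q : List Bool × ℕ) n => p q.1 q.2 n) := by
      have : Primrec₂ (fun (q : List Bool × ℕ) n => (Option.casesOn (F q.1 (Nat.pair q.2 n)) true (fun v => v == 0) : Bool)) := by
        refine Primrec.option_casesOn (pF.comp (Primrec.fst.comp Primrec.fst) (Primrec₂.natPair.comp (Primrec.snd.comp Primrec.fst) Primrec.snd)) (Primrec.const true) ?_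
        exact Primrec.beq.comp Primrec.snd (Primrec.const 0)
      refine this.of_eq (fun q n => ?_)
      simp only [p]
      cases F q.1 (Nat.pair q.2 n) <;> rfl
    have hix : Primrec₂ ix :=
      Primrec.list_findIdx (Primrec.list_range.comp (Primrec.list_length.comp Primrec.fst)) hp
    refine Primrec.ite (Primrec.eq.comp (pF.comp Primrec.fst (Primrec₂.natPair.comp Primrec.snd hix)) (Primrec.const _)) (Primrec.option_some.comp hix) (Primrec.const none)
  refine ⟨R, pR, ?_, ?_⟩
  · intro σ τ n y h
    rw [spec, spec]
    rintro ⟨h1, h2, h3⟩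
    refine ⟨h1.trans h.length_le, mF _ _ _ _ h h2, fun j hj => ?_⟩
    obtain ⟨v, hv, hv'⟩ := h3 j hj
    exact ⟨v, hv, mF _ _ _ _ h hv'⟩
  · intro a n
    simp only [spec]
    refine Nat.mem_rfind.trans ?_
    simp only [Part.map_eq_map, Part.mem_map_iff]
    constructor
    · rintro ⟨⟨x, hx, hx0⟩, h2⟩
      have hx0 : x = 0 := by simpa using hx0
      subst hx0
      obtain ⟨k, hk⟩ := (hF _ _).1 hx
      have : ∀ N ≤ n, ∃ l, ∀ j < N, ∃ v, v ≠ 0 ∧ F (seg S l) (Nat.pair a j) = some v := by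
        intro N
        induction N with
        | zero => intro _; exact ⟨0, by simp⟩
        | succ N ih =>
          intro hN
          obtain ⟨l, hl⟩ := ih (by omega)
          obtain ⟨v, hv, hv0⟩ := h2 (m := N) (by omega)
          have hv0 : v ≠ 0 := by simpa using hv0
          obtain ⟨l', hl'⟩ := (hF _ _).1 hv
          refine ⟨max l l', fun j hj => ?_⟩
          rcases Nat.lt_succ_iff_lt_or_eq.1 hj with hj | rfl
          · obtain ⟨v, h1, h2⟩ := hl j hj
            exact ⟨v, h1, mF _ _ _ _ (seg_prefix S (le_max_left _ _)) h2⟩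
          · exact ⟨v, hv0, mF _ _ _ _ (seg_prefix S (le_max_right _ _)) hl'⟩
      obtain ⟨l, hl⟩ := this n le_rfl
      refine ⟨max (max k l) n, by simp [seg_length], mF _ _ _ _ (seg_prefix S (by simp)) hk, fun j hj => ?_⟩
      obtain ⟨v, h1, h2⟩ := hl j hj
      exact ⟨v, h1, mF _ _ _ _ (seg_prefix S (by simp)) h2⟩
    · rintro ⟨k, _, h0, h1⟩
      refine ⟨⟨0, (hF _ _).2 ⟨k, h0⟩, by simp⟩, fun {m} hm => ?_⟩
      obtain ⟨v, hv, hv'⟩ := h1 m hm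
      exact ⟨v, (hF _ _).2 ⟨k, hv'⟩, by simp [hv]⟩

theorem nf_of_recIn {S : Set ℕ} {f : ℕ →. ℕ} (h : RecIn (chi S) f) : NF S f := by
  induction h with
  | oracle => exact NF.oracle S
  | zero => exact NF.of_total (Primrec.const 0)
  | succ => exact NF.of_total Primrec.succ
  | left => exact NF.of_total (Primrec.fst.comp Primrec.unpair)
  | right => exact NF.of_total (Primrec.snd.comp Primrec.unpair)
  | pair _ _ h1 h2 => exact NF.pair h1 h2
  | comp _ _ h1 h2 => exact NF.comp h1 h2
  | prec _ _ h1 h2 => exact NF.prec h1 h2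
  | rfind _ h1 => exact NF.rfind h1

/-- `m` is enumerated by code `e` from oracle string `ρ` in `s` steps. -/
def Enum (e : Nat.Partrec.Code) (s : ℕ) (ρ : List Bool) (m : ℕ) : Prop :=
  Nat.Partrec.Code.evaln s e (encode (ρ, m)) = some 1

theorem exists_enum {S T : Set ℕ} (h : TRed T S) :
    ∃ e : Nat.Partrec.Code, ∀ m, m ∈ T ↔ ∃ s k, Enum e s (seg S k) m := by
  obtain ⟨F, pF, mF, hF⟩ := nf_of_recIn h
  have hc : Computable (fun q : List Bool × ℕ => if F q.1 q.2 = some 1 then 1 else 0) :=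
    (Primrec.ite (Primrec.eq.comp pF (Primrec.const (some 1))) (Primrec.const 1)
      (Primrec.const 0)).to_comp
  obtain ⟨e, he⟩ := Nat.Partrec.Code.exists_code.1 hc
  refine ⟨e, fun m => ?_⟩
  have h1 : m ∈ T ↔ 1 ∈ (Part.some (chi T m)) := by
    by_cases hm : m ∈ T <;> simp [chi, hm]
  rw [h1, hF]
  rw [exists_comm]
  refine exists_congr fun k => ?_
  have h2 := Nat.Partrec.Code.evaln_complete (c := e) (n := encode (seg S k, m)) (x := 1)
  simp only [Enum]
  simp only [Option.mem_def] at h2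
  rw [← h2, he]
  simp only [encodek, PFun.coe_val, Part.coe_some, Part.bind_some, Part.map_some, Part.mem_some_iff]
  by_cases hh : F (seg S k) m = some 1 <;> simp [hh]

end S10

end


section
open scoped Classical
open Encodable

namespace S10

/-- translation of codes to oracle codes -/
def tr : Nat.Partrec.Code → OCode
  | .zero => .zero
  | .succ => .succ
  | .left => .left
  | .right => .right
  | .pair a b => .pair (tr a) (tr b)
  | .comp a b => .comp (tr a) (tr b)
  | .prec a b => .prec (tr a) (tr b)
  | .rfind' a => .rfind' (tr a)

theorem evalo_tr (O : ℕ → ℕ) (c : Nat.Partrec.Code) : evalo O (tr c) = c.eval := by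
  induction c with
  | zero => rfl
  | succ => rfl
  | left => rfl
  | right => rfl
  | pair a b h1 h2 => simp [tr, evalo, Nat.Partrec.Code.eval, h1, h2]; rfl
  | comp a b h1 h2 => simp [tr, evalo, Nat.Partrec.Code.eval, h1, h2]; rfl
  | prec a b h1 h2 => simp [tr, evalo, Nat.Partrec.Code.eval, h1, h2]; rfl
  | rfind' a h1 => simp [tr, evalo, Nat.Partrec.Code.eval, h1]; rfl

theorem div2_aux (m : ℕ) : (4*m).bodd = false ∧ (4*m).div2.bodd = false ∧ (4*m).div2.div2 = m ∧
    (4*m+1).bodd = true ∧ (4*m+1).div2.bodd = false ∧ (4*m+1).div2.div2 = m ∧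
    (4*m+2).bodd = false ∧ (4*m+2).div2.bodd = true ∧ (4*m+2).div2.div2 = m ∧
    (4*m+3).bodd = true ∧ (4*m+3).div2.bodd = true ∧ (4*m+3).div2.div2 = m := by
  have h0 : (4*m).div2 = 2*m := by rw [Nat.div2_val]; omega
  have h1 : (4*m+1).div2 = 2*m := by rw [Nat.div2_val]; omega
  have h2 : (4*m+2).div2 = 2*m+1 := by rw [Nat.div2_val]; omega
  have h3 : (4*m+3).div2 = 2*m+1 := by rw [Nat.div2_val]; omega
  rw [h0, h1, h2, h3]
  refine ⟨?_, ?_, ?_, ?_, ?_, ?_, ?_, ?_, ?_, ?_, ?_, ?_⟩ <;>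
    first
    | (rw [Nat.div2_val]; omega)
    | simp

theorem ofNat_pair (a b : ℕ) : ofNatOCode (4 * Nat.pair a b + 5) = .pair (ofNatOCode a) (ofNatOCode b) := by
  obtain ⟨h1, h2, h3, _⟩ := div2_aux (Nat.pair a b)
  rw [ofNatOCode]; simp [h1, h2, h3]

theorem ofNat_prec (a b : ℕ) : ofNatOCode (4 * Nat.pair a b + 1 + 5) = .prec (ofNatOCode a) (ofNatOCode b) := by
  obtain ⟨-, -, -, h1, h2, h3, _⟩ := div2_aux (Nat.pair a b)
  rw [ofNatOCode]; simp only [h1, h2, h3, Nat.unpair_pair]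

theorem ofNat_comp (a b : ℕ) : ofNatOCode (4 * Nat.pair a b + 2 + 5) = .comp (ofNatOCode a) (ofNatOCode b) := by
  obtain ⟨-, -, -, -, -, -, h1, h2, h3, _⟩ := div2_aux (Nat.pair a b)
  rw [ofNatOCode]; simp only [h1, h2, h3, Nat.unpair_pair]

theorem ofNat_rfind (a : ℕ) : ofNatOCode (4 * a + 3 + 5) = .rfind' (ofNatOCode a) := by
  obtain ⟨-, -, -, -, -, -, -, -, -, h1, h2, h3⟩ := div2_aux a
  rw [ofNatOCode]; simp only [h1, h2, h3]

theorem exists_num (c : Nat.Partrec.Code) : ∃ e, ofNatOCode e = tr c := by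
  induction c with
  | zero => exact ⟨0, by rw [ofNatOCode]; rfl⟩
  | succ => exact ⟨1, by rw [ofNatOCode]; rfl⟩
  | left => exact ⟨2, by rw [ofNatOCode]; rfl⟩
  | right => exact ⟨3, by rw [ofNatOCode]; rfl⟩
  | pair a b h1 h2 =>
    obtain ⟨x, hx⟩ := h1; obtain ⟨y, hy⟩ := h2
    exact ⟨_, (ofNat_pair x y).trans (by rw [hx, hy]; rfl)⟩
  | comp a b h1 h2 =>
    obtain ⟨x, hx⟩ := h1; obtain ⟨y, hy⟩ := h2
    exact ⟨_, (ofNat_comp x y).trans (by rw [hx, hy]; rfl)⟩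
  | prec a b h1 h2 =>
    obtain ⟨x, hx⟩ := h1; obtain ⟨y, hy⟩ := h2
    exact ⟨_, (ofNat_prec x y).trans (by rw [hx, hy]; rfl)⟩
  | rfind' a h1 =>
    obtain ⟨x, hx⟩ := h1
    exact ⟨_, (ofNat_rfind x).trans (by rw [hx]; rfl)⟩

/-- number of the constant code -/
def cnum : ℕ → ℕ
  | 0 => 0
  | x+1 => 4 * Nat.pair 1 (cnum x) + 2 + 5

theorem cnum_eval (O : ℕ → ℕ) (x n : ℕ) : evalo O (ofNatOCode (cnum x)) n = Part.some x := by
  induction x with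
  | zero => rw [cnum, ofNatOCode]; rfl
  | succ x ih =>
    rw [cnum, ofNat_comp]
    simp only [evalo, ih]
    refine (Part.bind_some _ _).trans ?_
    rw [ofNatOCode]; rfl

theorem cnum_primrec : Primrec cnum := by
  have : Primrec (fun x : ℕ => (x.rec 0 (fun _ r => 4 * Nat.pair 1 r + 2 + 5) : ℕ)) := by
    refine Primrec.nat_rec' (h := fun _ q => 4 * Nat.pair 1 q.2 + 2 + 5) Primrec.id (Primrec.const 0) ?_
    refine Primrec.nat_add.comp (Primrec.nat_add.comp (Primrec.nat_mul.comp (Primrec.const 4) ?_) (Primrec.const 2)) (Primrec.const 5)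
    exact Primrec₂.natPair.comp (Primrec.const 1) (Primrec.snd.comp Primrec.snd)
  refine this.of_eq (fun x => ?_)
  induction x with
  | zero => rfl
  | succ x ih => simp only [cnum, ← ih]

theorem K_sigma {α : Type} [Primcodable α] {R : α × ℕ → Bool} (hR : Computable R) :
    RC (chi K) (fun a => decide (∃ N, R (a, N) = true)) := by
  have hp : Partrec (fun a : α => Nat.rfind (fun N => (Part.some (R (a, N)) : Part Bool))) :=
    Partrec.rfind (p := fun a N => (Part.some (R (a, N)) : Part Bool)) hR.to₂
  obtain ⟨c, hc⟩ := Nat.Partrec.Code.exists_code.1 hp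
  obtain ⟨e, he⟩ := exists_num c
  refine ⟨fun x => chi K (4 * Nat.pair e (cnum x) + 2 + 5), ?_, ?_⟩
  · refine RT.comp (O := chi K) (f := chi K) RecIn.oracle (RT.of_computable ?_)
    exact (Primrec.nat_add.comp (Primrec.nat_add.comp (Primrec.nat_mul.comp (Primrec.const 4) 
      (Primrec₂.natPair.comp (Primrec.const e) cnum_primrec)) (Primrec.const 2)) (Primrec.const 5)).to_comp
  · intro a
    have : (4 * Nat.pair e (cnum (encode a)) + 2 + 5) ∈ K ↔ ∃ N, R (a, N) = true := by
      show (evalo (chi ∅) (ofNatOCode (4 * Nat.pair e (cnum (encode a)) + 2 + 5)) _).Dom ↔ _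
      rw [ofNat_comp]
      simp only [evalo, cnum_eval]
      rw [he, evalo_tr, hc]
      have hb : ∀ g : ℕ →. ℕ, ((Part.some (encode a) >>= g).Dom ↔ (g (encode a)).Dom) := fun g => by
        have : (Part.some (encode a) >>= g) = g (encode a) := Part.bind_some _ _
        rw [this]
      refine (hb _).trans ?_
      simp only [encodek, Part.coe_some, Part.bind_some]
      show (Nat.rfind _).Dom ↔ _
      refine Nat.rfind_dom.trans ?_
      constructor
      · rintro ⟨n, h, -⟩
        exact ⟨n, (Part.mem_some_iff.1 h).symm⟩
      · rintro ⟨n, h⟩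
        exact ⟨n, Part.mem_some_iff.2 h.symm, fun _ => trivial⟩
    by_cases h : ∃ N, R (a, N) = true
    · show (if _ ∈ K then 1 else 0) = _; rw [if_pos (this.2 h)]; beta_reduce; rw [decide_eq_true h]; rfl
    · show (if _ ∈ K then 1 else 0) = _; rw [if_neg (fun h' => h (this.1 h'))]; beta_reduce; rw [decide_eq_false h]; rfl

end S10

end


section
open scoped Classical
open Encodable

namespace S10

section
variable {α β : Type} [Primcodable α] [Primcodable β]

theorem P_ex_lt {p : α → ℕ → Prop} {f : α → ℕ} (hp : PrimrecPred fun q : α × ℕ => p q.1 q.2)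
    (hf : Primrec f) : PrimrecPred (fun a => ∃ x < f a, p a x) := by
  have h1 : PrimrecRel (fun (x : ℕ) (a : α) => p a x) :=
    PrimrecPred.comp hp (Primrec.snd.pair Primrec.fst)
  exact ((PrimrecRel.exists_mem_list h1).comp (Primrec.list_range.comp hf) Primrec.id).of_eq (fun a => by simp)

theorem P_all_lt {p : α → ℕ → Prop} {f : α → ℕ} (hp : PrimrecPred fun q : α × ℕ => p q.1 q.2)
    (hf : Primrec f) : PrimrecPred (fun a => ∀ x < f a, p a x) := by
  have h1 : PrimrecRel (fun (x : ℕ) (a : α) => p a x) :=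
    PrimrecPred.comp hp (Primrec.snd.pair Primrec.fst)
  exact ((PrimrecRel.forall_mem_list h1).comp (Primrec.list_range.comp hf) Primrec.id).of_eq (fun a => by simp)

theorem P_all_mem {p : α → β → Prop} {f : α → List β} (hp : PrimrecPred fun q : α × β => p q.1 q.2)
    (hf : Primrec f) : PrimrecPred (fun a => ∀ x ∈ f a, p a x) := by
  have h1 : PrimrecRel (fun (x : β) (a : α) => p a x) :=
    PrimrecPred.comp hp (Primrec.snd.pair Primrec.fst)
  exact (PrimrecRel.forall_mem_list h1).comp hf Primrec.id

theorem P_imp {p q : α → Prop} (hp : PrimrecPred p) (hq : PrimrecPred q) :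
    PrimrecPred (fun a => p a → q a) :=
  (hp.not.or hq).of_eq (fun a => by tauto)
end

/-- all strings of a given length -/
def allStr : ℕ → List (List Bool)
  | 0 => [[]]
  | n+1 => (allStr n).flatMap (fun ρ => [ρ ++ [false], ρ ++ [true]])

theorem mem_allStr {n : ℕ} {ρ : List Bool} : ρ ∈ allStr n ↔ ρ.length = n := by
  induction n generalizing ρ with
  | zero => simp [allStr]
  | succ n ih =>
    simp only [allStr, List.mem_flatMap, ih]
    constructor
    · rintro ⟨τ, hτ, h⟩
      simp at h
      rcases h with rfl | rfl <;> simp [hτ]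
    · intro h
      rcases List.eq_nil_or_concat ρ with rfl | ⟨τ, b, rfl⟩
      · simp at h
      · refine ⟨τ, by simpa using h, ?_⟩
        cases b <;> simp

theorem allStr_primrec : Primrec allStr := by
  have : Primrec (fun x : ℕ => (x.rec [[]] (fun _ r => r.flatMap (fun ρ => [ρ ++ [false], ρ ++ [true]])) : List (List Bool))) := by
    refine Primrec.nat_rec' (h := fun _ (q : ℕ × List (List Bool)) => q.2.flatMap (fun ρ => [ρ ++ [false], ρ ++ [true]])) Primrec.id (Primrec.const _) ?_
    refine Primrec.list_flatMap (Primrec.snd.comp Primrec.snd) ?_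
    refine Primrec.list_cons.comp (Primrec.list_append.comp Primrec.snd (Primrec.const _)) ?_
    refine Primrec.list_cons.comp (Primrec.list_append.comp Primrec.snd (Primrec.const _)) (Primrec.const _)
  refine this.of_eq (fun x => ?_)
  induction x with
  | zero => rfl
  | succ x ih => simp only [allStr, ← ih]

/-- prefix of an infinite sequence -/
def pre (D : ℕ → Bool) (N : ℕ) : List Bool := (List.range N).map D

theorem pre_length (D : ℕ → Bool) (N : ℕ) : (pre D N).length = N := by simp [pre]

theorem pre_take (D : ℕ → Bool) {N N' : ℕ} (h : N' ≤ N) : (pre D N).take N' = pre D N' := by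
  simp [pre, ← List.map_take, List.take_range, h]

theorem pre_getElem? (D : ℕ → Bool) (N x : ℕ) : (pre D N)[x]? = if x < N then some (D x) else none := by
  unfold pre
  by_cases h : x < N <;> simp [h]

theorem pre_getD (ρ : List Bool) : pre (fun x => ρ.getD x false) ρ.length = ρ := by
  apply List.ext_getElem?
  intro i
  rw [pre_getElem?]
  by_cases h : i < ρ.length
  · simp [h]
  · simp [h]

theorem isClosed_pre (v : List Bool → Bool) (N : ℕ) : IsClosed {D : ℕ → Bool | v (pre D N) = false} := by
  have h1 : Continuous (fun D : ℕ → Bool => (fun k : Fin N => D k)) := by fun_prop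
  have h2 : Continuous (fun d : Fin N → Bool => v (List.ofFn d)) := continuous_of_discreteTopology
  have h3 := h2.comp h1
  have h4 : ∀ D : ℕ → Bool, List.ofFn (fun k : Fin N => D k) = pre D N := by
    intro D
    apply List.ext_getElem?
    intro i
    rw [pre_getElem?, List.getElem?_ofFn]
    by_cases h : i < N <;> simp [h]
  have : IsClosed ((fun D : ℕ → Bool => v (pre D N)) ⁻¹' {false}) := by
    have h5 : (fun D : ℕ → Bool => v (pre D N)) = (fun d : Fin N → Bool => v (List.ofFn d)) ∘ (fun D : ℕ → Bool => (fun k : Fin N => D k)) := by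
      funext D; simp [h4]
    rw [h5]
    exact (isClosed_discrete _).preimage h3
  exact this

theorem nested_nonempty (E : ℕ → Set (ℕ → Bool)) (hc : ∀ n, IsClosed (E n)) (hd : ∀ n, E (n+1) ⊆ E n)
    (hn : ∀ n, (E n).Nonempty) : ∃ D, ∀ n, D ∈ E n := by
  obtain ⟨D, hD⟩ := IsCompact.nonempty_iInter_of_sequence_nonempty_isCompact_isClosed E hd hn
    (hc 0).isCompact hc
  exact ⟨D, fun n => Set.mem_iInter.1 hD n⟩

theorem low_basis (V : ℕ → List Bool → Bool) (hV : Primrec₂ V) :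
    ∃ (D b : ℕ → Bool), RC (chi K) b ∧ (∀ j, b j = true → ∀ N, V j (pre D N) = false) ∧
      ∀ j, b j = false → ∀ D' : ℕ → Bool, (∀ i < j, b i = true → ∀ N, V i (pre D' N) = false) →
        ∃ N, V j (pre D' N) = true := by
  let T : List Bool × ℕ → Prop := fun q => ∀ ρ ∈ allStr q.2, ∃ i < q.1.length + 1, ∃ N' < q.2 + 1,
    (i = q.1.length ∨ q.1[i]? = some true) ∧ V i (ρ.take N') = true
  have hT : PrimrecPred T := by
    refine P_all_mem (p := fun (q : List Bool × ℕ) ρ => ∃ i < q.1.length + 1, ∃ N' < q.2 + 1,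
      (i = q.1.length ∨ q.1[i]? = some true) ∧ V i (ρ.take N') = true) ?_ (allStr_primrec.comp Primrec.snd)
    refine P_ex_lt (p := fun (q : (List Bool × ℕ) × List Bool) i => ∃ N' < q.1.2 + 1,
      (i = q.1.1.length ∨ q.1.1[i]? = some true) ∧ V i (q.2.take N') = true) ?_
      (Primrec.succ.comp (Primrec.list_length.comp (Primrec.fst.comp Primrec.fst)))
    refine P_ex_lt (p := fun (q : ((List Bool × ℕ) × List Bool) × ℕ) N' => 
      (q.2 = q.1.1.1.length ∨ q.1.1.1[q.2]? = some true) ∧ V q.2 (q.1.2.take N') = true) ?_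
      (Primrec.succ.comp (Primrec.snd.comp (Primrec.fst.comp Primrec.fst)))
    have hβ : Primrec (fun q : (((List Bool × ℕ) × List Bool) × ℕ) × ℕ => q.1.1.1.1) :=
      Primrec.fst.comp (Primrec.fst.comp (Primrec.fst.comp Primrec.fst))
    have hi : Primrec (fun q : (((List Bool × ℕ) × List Bool) × ℕ) × ℕ => q.1.2) :=
      Primrec.snd.comp Primrec.fst
    refine PrimrecPred.and (PrimrecPred.or (Primrec.eq.comp hi (Primrec.list_length.comp hβ))
      (Primrec.eq.comp (Primrec.list_getElem?.comp hβ hi) (Primrec.const _))) ?_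
    refine Primrec.eq.comp (hV.comp hi (Primrec.list_take.comp Primrec.snd (Primrec.snd.comp (Primrec.fst.comp Primrec.fst)))) (Primrec.const _)
  let Q : List Bool → Bool := fun β => ! decide (∃ N, decide (T (β, N)) = true)
  have hQ : RC (chi K) Q := by
    have := K_sigma (R := fun q => decide (T q)) hT.decide.to_comp
    exact RC.comp (f := not) (RC.of_primrec Primrec.not) this
  let step : List Bool → List Bool := fun β => β ++ [Q β]
  have hstep : RC (chi K) step := by
    have h1 : RC (chi K) (fun q : List Bool × Bool => q.1 ++ [q.2]) :=
      RC.of_primrec (Primrec.list_append.comp Primrec.fst (Primrec.list_cons.comp Primrec.snd (Primrec.const [])))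
    exact RC.comp h1 (RC.pair (RC.of_primrec Primrec.id) hQ)
  let bl : ℕ → List Bool := fun n => step^[n] []
  have hbl : RC (chi K) bl := RC.comp (RC.iterate hstep) (RC.of_primrec ((Primrec.const []).pair Primrec.id))
  let b : ℕ → Bool := fun n => Q (bl n)
  have bls : ∀ n, bl (n+1) = bl n ++ [b n] := fun n => Function.iterate_succ_apply' _ _ _
  have bll : ∀ n, (bl n).length = n := by
    intro n
    induction n with
    | zero => rfl
    | succ n ih => rw [bls]; simp [ih]
  have blg : ∀ n i, i < n → (bl n)[i]? = some (b i) := by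
    intro n
    induction n with
    | zero => intro i hi; omega
    | succ n ih =>
      intro i hi
      rw [bls]
      rcases Nat.lt_succ_iff_lt_or_eq.1 hi with h | rfl
      · rw [List.getElem?_append_left (by rw [bll]; exact h)]; exact ih i h
      · rw [List.getElem?_append_right (by rw [bll])]; simp [bll]
  have bT : ∀ n, b n = false ↔ ∃ N, T (bl n, N) := by
    intro n; simp [b, Q]
  have active : ∀ j i, i < j + 1 → ((i = (bl j).length ∨ (bl j)[i]? = some true) ↔ (i = j ∨ b i = true)) := by
    intro j i hi
    rw [bll]
    rcases Nat.lt_succ_iff_lt_or_eq.1 hi with h | rfl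
    · rw [blg j i h]; simp
    · simp
  let C : ℕ → Set (ℕ → Bool) := fun j => {D | ∀ i < j, b i = true → ∀ N, V i (pre D N) = false}
  have hCc : ∀ j, IsClosed (C j) := by
    intro j
    simp only [C, Set.ofPred_forall]
    exact isClosed_iInter fun i => isClosed_iInter fun _ => isClosed_iInter fun _ => isClosed_iInter fun N => isClosed_pre _ _
  have hCn : ∀ j, (C j).Nonempty := by
    intro j
    induction j with
    | zero => exact ⟨fun _ => true, fun i hi => by omega⟩
    | succ j ih =>
      cases hb : b j with
      | false =>
        obtain ⟨D, hD⟩ := ih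
        refine ⟨D, fun i hi hbi => ?_⟩
        rcases Nat.lt_succ_iff_lt_or_eq.1 hi with h | rfl
        · exact hD i h hbi
        · rw [hb] at hbi; cases hbi
      | true =>
        have hnT : ¬ ∃ N, T (bl j, N) := by rw [← bT, hb]; simp
        have key : ∃ D, ∀ N, D ∈ {D : ℕ → Bool | ∀ i < j + 1, b i = true → ∀ N' < N + 1, V i (pre D N') = false} := by
          refine nested_nonempty (fun N => {D | ∀ i < j + 1, b i = true → ∀ N' < N + 1, V i (pre D N') = false}) ?_ ?_ ?_
          · intro n
            simp only [Set.ofPred_forall]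
            exact isClosed_iInter fun i => isClosed_iInter fun _ => isClosed_iInter fun _ => isClosed_iInter fun N => isClosed_iInter fun _ => isClosed_pre _ _
          · intro n D hD i hi hbi N' hN'
            exact hD i hi hbi N' (by omega)
          · intro N
            have h1 := not_exists.1 hnT N
            simp only [T, not_forall] at h1
            obtain ⟨ρ, hρ, h2⟩ := h1
            rw [mem_allStr] at hρ
            refine ⟨fun x => ρ.getD x false, fun i hi hbi N' hN' => ?_⟩
            have h3 : pre (fun x => ρ.getD x false) N' = ρ.take N' := by
              conv_rhs => rw [← pre_getD ρ]
              rw [pre_take _ (by omega)]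
            rw [h3]
            by_contra h4
            exact h2 ⟨i, by rw [bll]; exact hi, N', hN', (active j i hi).2 (Or.inr hbi), by simpa using h4⟩
        obtain ⟨D, hD⟩ := key
        exact ⟨D, fun i hi hbi N => hD N i hi hbi N (by omega)⟩
  obtain ⟨D, hD⟩ := nested_nonempty C hCc (fun n D hD i hi => hD i (by omega)) hCn
  refine ⟨D, b, RC.comp hQ hbl, fun j hj N => hD (j+1) j (by omega) hj N, ?_⟩
  intro j hj D' hD'
  obtain ⟨N, hN⟩ := (bT j).1 hj
  obtain ⟨i, hi, N', hN', hact, hv⟩ := hN (pre D' N) (mem_allStr.2 (pre_length _ _))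
  rw [bll] at hi
  have hN'' : N' < N + 1 := hN'
  rw [pre_take _ (by omega)] at hv
  rcases (active j i hi).1 hact with rfl | hbi
  · exact ⟨N', hv⟩
  · rcases Nat.lt_succ_iff_lt_or_eq.1 hi with h | rfl
    · rw [hD' i h hbi N'] at hv; cases hv
    · exact ⟨N', hv⟩

end S10

end


section
open scoped Classical
open Encodable
open Nat.Partrec (Code)

namespace S10

/-- parameters: strings, reservoir, codes, polarities -/
abbrev Par := (List Bool × List Bool) × List (ℕ × Bool) × (Code × Code) × (Bool × Bool)
/-- witnesses: side, string, element, stage -/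
abbrev Wit := Bool × List Bool × ℕ × ℕ

def sg (s : List Bool × List Bool) (i : Bool) : List Bool := cond i s.1 s.2
def cdd (s : Code × Code) (i : Bool) : Code := cond i s.1 s.2
def po (s : Bool × Bool) (i : Bool) : Bool := cond i s.1 s.2

/-- the basic bad event -/
def Bad (c : ℕ) (a : Par × ℕ) (δ : List Bool) (W : Wit) : Prop :=
  a.2 ≤ W.2.2.1 ∧ Enum (cdd a.1.2.2.1 W.1) W.2.2.2 W.2.1 W.2.2.1 ∧
  ∀ x < W.2.1.length, (x < (sg a.1.1 W.1).length → W.2.1[x]? = (sg a.1.1 W.1)[x]?) ∧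
    ((sg a.1.1 W.1).length ≤ x → W.2.1[x]? = some true →
      δ[Nat.pair c x]? = some W.1 ∧ ∀ l ∈ a.1.2.1, δ[Nat.pair l.1 x]? = some l.2)

theorem Bad.mono {c : ℕ} {a : Par × ℕ} {δ δ' : List Bool} {W : Wit} (h : Bad c a δ W)
    (h1 : ∀ x v, δ[Nat.pair c x]? = some v → δ'[Nat.pair c x]? = some v)
    (h2 : ∀ l ∈ a.1.2.1, ∀ x v, δ[Nat.pair l.1 x]? = some v → δ'[Nat.pair l.1 x]? = some v) :
    Bad c a δ' W := by
  refine ⟨h.1, h.2.1, fun x hx => ⟨(h.2.2 x hx).1, fun h3 h4 => ?_⟩⟩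
  have := (h.2.2 x hx).2 h3 h4
  exact ⟨h1 _ _ this.1, fun l hl => h2 l hl _ _ (this.2 l hl)⟩

theorem Bad_gen {α : Type} [Primcodable α] {c n m s : α → ℕ} {δ ρ σ : α → List Bool} {e : α → Code}
    {i : α → Bool} {L : α → List (ℕ × Bool)} (hc : Primrec c) (hn : Primrec n) (hm : Primrec m)
    (hs : Primrec s) (hδ : Primrec δ) (hρ : Primrec ρ) (hσ : Primrec σ) (he : Primrec e) (hi : Primrec i)
    (hL : Primrec L) : PrimrecPred (fun a => n a ≤ m a ∧ Enum (e a) (s a) (ρ a) (m a) ∧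
      ∀ x < (ρ a).length, (x < (σ a).length → (ρ a)[x]? = (σ a)[x]?) ∧
        ((σ a).length ≤ x → (ρ a)[x]? = some true →
        (δ a)[Nat.pair (c a) x]? = some (i a) ∧ ∀ l ∈ L a, (δ a)[Nat.pair l.1 x]? = some l.2)) := by
  refine PrimrecPred.and (Primrec.nat_le.comp hn hm) (PrimrecPred.and ?_ ?_)
  · refine Primrec.eq.comp (Nat.Partrec.Code.primrec_evaln.comp ((hs.pair he).pair ?_)) (Primrec.const (some 1))
    exact Primrec.encode.comp (hρ.pair hm)
  · refine P_all_lt (p := fun (a : α) x =>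
      (x < (σ a).length → (ρ a)[x]? = (σ a)[x]?) ∧
        ((σ a).length ≤ x → (ρ a)[x]? = some true →
        (δ a)[Nat.pair (c a) x]? = some (i a) ∧ ∀ l ∈ L a, (δ a)[Nat.pair l.1 x]? = some l.2))
      ?_ (Primrec.list_length.comp hρ)
    have f : Primrec (fun r : α × ℕ => r.1) := Primrec.fst
    refine PrimrecPred.and (P_imp ?_ ?_) (P_imp ?_ (P_imp ?_ (PrimrecPred.and ?_ ?_)))
    · exact Primrec.nat_lt.comp Primrec.snd (Primrec.list_length.comp (hσ.comp f))
    · exact Primrec.eq.comp (Primrec.list_getElem?.comp (hρ.comp f) Primrec.snd)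
        (Primrec.list_getElem?.comp (hσ.comp f) Primrec.snd)
    · exact Primrec.nat_le.comp (Primrec.list_length.comp (hσ.comp f)) Primrec.snd
    · exact Primrec.eq.comp (Primrec.list_getElem?.comp (hρ.comp f) Primrec.snd) (Primrec.const (some true))
    · exact Primrec.eq.comp (Primrec.list_getElem?.comp (hδ.comp f) (Primrec₂.natPair.comp (hc.comp f) Primrec.snd))
        (Primrec.option_some.comp (hi.comp f))
    · refine P_all_mem (p := fun (r : α × ℕ) (l : ℕ × Bool) =>
        (δ r.1)[Nat.pair l.1 r.2]? = some l.2) ?_ (hL.comp f)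
      exact Primrec.eq.comp (Primrec.list_getElem?.comp (hδ.comp (f.comp Primrec.fst))
        (Primrec₂.natPair.comp (Primrec.fst.comp Primrec.snd) (Primrec.snd.comp Primrec.fst)))
        (Primrec.option_some.comp (Primrec.snd.comp Primrec.snd))

theorem Bad_primrec {α : Type} [Primcodable α] {c : α → ℕ} {a : α → Par × ℕ} {δ : α → List Bool} {W : α → Wit}
    (hc : Primrec c) (ha : Primrec a) (hδ : Primrec δ) (hW : Primrec W) :
    PrimrecPred (fun q => Bad (c q) (a q) (δ q) (W q)) := by
  have hP := Primrec.fst.comp ha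
  have hi := Primrec.fst.comp hW
  have hρ := Primrec.fst.comp (Primrec.snd.comp hW)
  have hm := Primrec.fst.comp (Primrec.snd.comp (Primrec.snd.comp hW))
  have hs := Primrec.snd.comp (Primrec.snd.comp (Primrec.snd.comp hW))
  have hL := Primrec.fst.comp (Primrec.snd.comp hP)
  have hE := Primrec.fst.comp (Primrec.snd.comp (Primrec.snd.comp hP))
  have hsg : Primrec (fun q => sg (a q).1.1 (W q).1) :=
    Primrec.cond hi (Primrec.fst.comp (Primrec.fst.comp hP)) (Primrec.snd.comp (Primrec.fst.comp hP))
  have hcd : Primrec (fun q => cdd (a q).1.2.2.1 (W q).1) :=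
    Primrec.cond hi (Primrec.fst.comp hE) (Primrec.snd.comp hE)
  exact Bad_gen hc (Primrec.snd.comp ha) hm hs hδ hρ hsg hcd hi hL

theorem V_primrec {E : ℕ → List Bool → Prop} (hE : PrimrecPred (fun q : ℕ × List Bool => E q.1 q.2)) :
    PrimrecRel (fun j δ => (j % 2 = 0 ∧ E (j/2) δ) ∨ (j % 2 = 1 ∧ δ[j/2]? = some true)) := by
  have h2 : Primrec (fun q : ℕ × List Bool => q.1 / 2) := Primrec.nat_div.comp Primrec.fst (Primrec.const 2)
  have h3 : Primrec (fun q : ℕ × List Bool => q.1 % 2) := Primrec.nat_mod.comp Primrec.fst (Primrec.const 2)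
  refine PrimrecPred.or (PrimrecPred.and (Primrec.eq.comp h3 (Primrec.const 0)) ?_)
    (PrimrecPred.and (Primrec.eq.comp h3 (Primrec.const 1)) ?_)
  · exact hE.comp (h2.pair Primrec.snd)
  · exact Primrec.eq.comp (Primrec.list_getElem?.comp Primrec.snd h2) (Primrec.const _)

theorem mem_lt_encode {α : Type} [Encodable α] {l : α} {L : List α} (h : l ∈ L) : encode l < encode L := by
  induction L with
  | nil => cases h
  | cons a L ih =>
    rw [Encodable.encode_list_cons]
    rcases List.mem_cons.1 h with rfl | h
    · exact Nat.lt_succ_of_le (Nat.left_le_pair _ _)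
    · exact (ih h).trans (Nat.lt_succ_of_le (Nat.right_le_pair _ _))

theorem encode_L_lt {a : Par × ℕ} {l : ℕ × Bool} (h : l ∈ a.1.2.1) : l.1 < encode a := by
  have h1 : l.1 ≤ encode l := by
    obtain ⟨u, v⟩ := l; rw [Encodable.encode_prod_val]; exact Nat.left_le_pair _ _
  have h2 := mem_lt_encode h
  have h3 : encode a.1.2.1 ≤ encode a := by
    obtain ⟨⟨s, L, r⟩, n⟩ := a
    simp only [Encodable.encode_prod_val]
    exact ((Nat.left_le_pair _ _).trans (Nat.right_le_pair _ _)).trans (Nat.left_le_pair _ _)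
  omega

theorem sg_le_encode (P : Par) (i : Bool) : (sg P.1 i).length ≤ encode P := by
  obtain ⟨⟨s0, s1⟩, r⟩ := P
  simp only [Encodable.encode_prod_val]
  refine le_trans ?_ (Nat.left_le_pair _ _)
  cases i
  · exact (Encodable.length_le_encode _).trans (Nat.right_le_pair _ _)
  · exact (Encodable.length_le_encode _).trans (Nat.left_le_pair _ _)

theorem RC.pre {α : Type} [Primcodable α] {O : ℕ → ℕ} {f : α × ℕ → Bool} (hf : RC O f) :
    RC O (fun q : α × ℕ => S10.pre (fun x => f (q.1, x)) q.2) := by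
  let step : α × List Bool → α × List Bool := fun s => (s.1, s.2 ++ [f (s.1, s.2.length)])
  have hstep : RC O step := by
    have h1 : RC O (fun q : (α × List Bool) × Bool => (q.1.1, q.1.2 ++ [q.2])) :=
      RC.of_primrec ((Primrec.fst.comp Primrec.fst).pair (Primrec.list_append.comp (Primrec.snd.comp Primrec.fst) (Primrec.list_cons.comp Primrec.snd (Primrec.const []))))
    have h2 : RC O (fun s : α × List Bool => f (s.1, s.2.length)) :=
      RC.comp hf (RC.of_primrec (Primrec.fst.pair (Primrec.list_length.comp Primrec.snd)))
    exact RC.comp h1 (RC.pair (RC.of_primrec Primrec.id) h2)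
  have h3 := RC.iterate hstep
  have h4 : RC O (fun q : α × ℕ => ((q.1, ([] : List Bool)), q.2)) :=
    RC.of_primrec ((Primrec.fst.pair (Primrec.const [])).pair Primrec.snd)
  have h5 : RC O (fun q : α × ℕ => (step^[q.2] (q.1, [])).2) := RC.comp (RC.of_primrec Primrec.snd) (RC.comp h3 h4)
  refine h5.of_eq ?_
  rintro ⟨a, n⟩
  have : step^[n] (a, []) = (a, S10.pre (fun x => f (a, x)) n) := by
    induction n with
    | zero => rfl
    | succ n ih =>
      rw [Function.iterate_succ_apply', ih]
      simp [step, S10.pre, List.range_succ]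
  simp [this]

theorem RC.of_tred {A : Set ℕ} {S : Set ℕ} (h : TRed A S) : RC (chi S) (fun x : ℕ => decide (x ∈ A)) := by
  refine ⟨chi A, h, fun x => ?_⟩
  by_cases hx : x ∈ A <;> simp [chi, hx]

/-- replace a column by `A` -/
noncomputable def sub (D : ℕ → Bool) (A : Set ℕ) (c : ℕ) : ℕ → Bool :=
  fun z => if z.unpair.1 = c then decide (z.unpair.2 ∈ A) else D z

theorem interface (A : Set ℕ) (hA : TRed A K) :
    ∃ (D : ℕ → Bool) (H : Par × ℕ → Option Wit), RC (chi K) H ∧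
      ∀ a, (H a = none → ∀ N W, ¬ Bad (encode a) a (pre D N) W) ∧
        ∀ W, H a = some W → ∃ N, Bad (encode a) a (pre (sub D A (encode a)) N) W := by
  let pa : ℕ → Par × ℕ := fun c => ((decode c : Option (Par × ℕ))).getD default
  let pw : ℕ → Wit := fun c => ((decode c : Option Wit)).getD default
  have hpa : Primrec pa := Primrec.option_getD.comp Primrec.decode (Primrec.const default)
  have hpw : Primrec pw := Primrec.option_getD.comp Primrec.decode (Primrec.const default)
  have pae : ∀ a, pa (encode a) = a := by intro a; show (decode (encode a)).getD default = a; rw [encodek]; rfl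
  have pwe : ∀ a, pw (encode a) = a := by intro a; show (decode (encode a)).getD default = a; rw [encodek]; rfl
  let E : ℕ → List Bool → Prop := fun c δ => encode (pa c) = c ∧ ∃ w < δ.length, Bad c (pa c) δ (pw w)
  have hE : PrimrecPred (fun q : ℕ × List Bool => E q.1 q.2) := by
    refine PrimrecPred.and (Primrec.eq.comp (Primrec.encode.comp (hpa.comp Primrec.fst)) Primrec.fst) ?_
    refine P_ex_lt (p := fun (q : ℕ × List Bool) w => Bad q.1 (pa q.1) q.2 (pw w)) ?_ (Primrec.list_length.comp Primrec.snd)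
    exact Bad_primrec (Primrec.fst.comp Primrec.fst) (hpa.comp (Primrec.fst.comp Primrec.fst)) (Primrec.snd.comp Primrec.fst) (hpw.comp Primrec.snd)
  let V : ℕ → List Bool → Prop := fun j δ => (j % 2 = 0 ∧ E (j/2) δ) ∨ (j % 2 = 1 ∧ δ[j/2]? = some true)
  have hV : PrimrecRel V := V_primrec hE
  obtain ⟨D, b, hb, h1, h2⟩ := low_basis (fun j δ => decide (V j δ)) hV.decide
  simp only [decide_eq_false_iff_not, decide_eq_true_eq] at h1 h2
  have Vev : ∀ c δ, V (2*c) δ ↔ E c δ := by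
    intro c δ
    have h3 : 2 * c / 2 = c := by omega
    have h4 : 2 * c % 2 = 0 := by omega
    simp [V, h3, h4]
  have Vod : ∀ c δ, V (2*c+1) δ ↔ δ[c]? = some true := by
    intro c δ
    have h3 : (2 * c + 1) / 2 = c := by omega
    have h4 : (2 * c + 1) % 2 = 1 := by omega
    simp [V, h3, h4]
  have hDb : ∀ x, D x = ! b (2*x+1) := by
    intro x
    cases hx : b (2*x+1) with
    | true =>
      have := h1 _ hx (x+1)
      rw [Vod, pre_getElem?] at this
      simpa using this
    | false =>
      obtain ⟨N, hN⟩ := h2 _ hx D (fun i _ hi N => h1 i hi N)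
      rw [Vod, pre_getElem?] at hN
      split_ifs at hN
      simpa using hN
  have hD : RC (chi K) D := by
    have : RC (chi K) (fun x => ! b (2*x+1)) := 
      RC.comp (RC.of_primrec Primrec.not) (RC.comp hb (RC.of_primrec (Primrec.succ.comp (Primrec.nat_mul.comp (Primrec.const 2) Primrec.id))))
    exact this.of_eq (fun x => (hDb x).symm)
  -- the substituted sequence
  have hsub : RC (chi K) (fun q : ℕ × ℕ => sub D A q.1 q.2) := by
    have g : Primrec (fun q : (ℕ × ℕ) × (Bool × Bool) => if q.1.2.unpair.1 = q.1.1 then q.2.1 else q.2.2) := by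
      refine Primrec.ite (Primrec.eq.comp ?_ (Primrec.fst.comp Primrec.fst)) (Primrec.fst.comp Primrec.snd) (Primrec.snd.comp Primrec.snd)
      exact Primrec.fst.comp (Primrec.unpair.comp (Primrec.snd.comp Primrec.fst))
    have g2 : RC (chi K) (fun q : ℕ × ℕ => decide (q.2.unpair.2 ∈ A)) :=
      RC.comp (RC.of_tred hA) (RC.of_primrec (Primrec.snd.comp (Primrec.unpair.comp Primrec.snd)))
    have g3 : RC (chi K) (fun q : ℕ × ℕ => D q.2) := RC.comp hD (RC.of_primrec Primrec.snd)
    exact RC.comp (RC.of_primrec g) (RC.pair (RC.of_primrec Primrec.id) (RC.pair g2 g3))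
  have hkey : ∀ a : Par × ℕ, b (2 * encode a) = false → ∃ k : ℕ, Bad (encode a) a (pre (sub D A (encode a)) k.unpair.1) (pw k.unpair.2) := by
    intro a ha
    have hh : ∀ i < 2 * encode a, b i = true → ∀ N, ¬ V i (pre (sub D A (encode a)) N) := by
      intro i hi hbi N hv
      apply h1 i hbi N
      rcases Nat.even_or_odd' i with ⟨c, rfl | rfl⟩
      · rw [Vev] at hv ⊢
        obtain ⟨hc, w, hw, hbad⟩ := hv
        refine ⟨hc, w, by rwa [pre_length] at hw ⊢, hbad.mono ?_ ?_⟩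
        · intro x v hx
          rw [pre_getElem?] at hx ⊢
          have : c ≠ encode a := by omega
          simpa [sub, this] using hx
        · intro l hl x v hx
          have h3 := encode_L_lt hl
          rw [pre_getElem?] at hx ⊢
          have : l.1 ≠ encode a := by omega
          simpa [sub, this] using hx
      · rw [Vod] at hv ⊢
        rw [pre_getElem?] at hv ⊢
        have h3 := Nat.unpair_left_le c
        have : c.unpair.1 ≠ encode a := by omega
        simpa [sub, this] using hv
    obtain ⟨N, hN⟩ := h2 _ ha (sub D A (encode a)) hh
    rw [Vev] at hN
    obtain ⟨-, w, -, hw⟩ := hN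
    rw [pae] at hw
    exact ⟨Nat.pair N w, by simpa using hw⟩
  let p : (Par × ℕ) × ℕ → Prop := fun q => b (2 * encode q.1) = true ∨ 
    Bad (encode q.1) q.1 (pre (sub D A (encode q.1)) q.2.unpair.1) (pw q.2.unpair.2)
  have hp : RC (chi K) (fun q => decide (p q)) := by
    have k1 : RC (chi K) (fun q : (Par × ℕ) × ℕ => b (2 * encode q.1)) :=
      RC.comp hb (RC.of_primrec (Primrec.nat_mul.comp (Primrec.const 2) (Primrec.encode.comp Primrec.fst)))
    have k2 : RC (chi K) (fun q : (Par × ℕ) × ℕ => pre (sub D A (encode q.1)) q.2.unpair.1) :=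
      RC.comp (RC.pre hsub) (RC.of_primrec ((Primrec.encode.comp Primrec.fst).pair 
        (Primrec.fst.comp (Primrec.unpair.comp Primrec.snd))))
    have k3 : PrimrecPred (fun r : ((Par × ℕ) × ℕ) × (Bool × List Bool) => r.2.1 = true ∨
        Bad (encode r.1.1) r.1.1 r.2.2 (pw r.1.2.unpair.2)) := by
      refine PrimrecPred.or (Primrec.eq.comp (Primrec.fst.comp Primrec.snd) (Primrec.const _)) ?_
      have kk : Primrec (fun r : ((Par × ℕ) × ℕ) × (Bool × List Bool) => r.1.1) := Primrec.fst.comp Primrec.fst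
      exact Bad_primrec (Primrec.encode.comp kk) kk (Primrec.snd.comp Primrec.snd) 
        (hpw.comp (Primrec.snd.comp (Primrec.unpair.comp (Primrec.snd.comp Primrec.fst))))
    exact RC.comp (RC.of_primrec k3.decide) (RC.pair (RC.of_primrec Primrec.id) (RC.pair k1 k2))
  have hex : ∀ a, ∃ n, decide (p (a, n)) = true := by
    intro a
    cases hba : b (2 * encode a) with
    | true => exact ⟨0, by simp [p, hba]⟩
    | false => 
      obtain ⟨k, hk⟩ := hkey a hba
      exact ⟨k, by simp only [decide_eq_true_eq]; exact Or.inr hk⟩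
  have hf := RC.find hp hex
  let H : Par × ℕ → Option Wit := fun a => if b (2 * encode a) = true then none else some (pw (Nat.find (hex a)).unpair.2)
  refine ⟨D, H, ?_, fun a => ⟨?_, ?_⟩⟩
  · have k1 : RC (chi K) (fun a : Par × ℕ => b (2 * encode a)) :=
      RC.comp hb (RC.of_primrec (Primrec.nat_mul.comp (Primrec.const 2) Primrec.encode))
    have k3 : Primrec (fun r : Bool × ℕ => if r.1 = true then (none : Option Wit) else some (pw r.2.unpair.2)) := by
      refine Primrec.ite (Primrec.eq.comp Primrec.fst (Primrec.const _)) (Primrec.const _) ?_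
      exact Primrec.option_some.comp (hpw.comp (Primrec.snd.comp (Primrec.unpair.comp Primrec.snd)))
    exact RC.comp (RC.of_primrec k3) (RC.pair k1 hf)
  · intro hH N W hbad
    have hba : b (2 * encode a) = true := by
      by_contra h
      simp [H, h] at hH
    apply h1 _ hba (max N (encode W + 1))
    rw [Vev]
    refine ⟨by rw [pae], encode W, by rw [pre_length]; omega, ?_⟩
    rw [pae, pwe]
    have mono : ∀ (z : ℕ) (v : Bool), (pre D N)[z]? = some v → (pre D (max N (encode W + 1)))[z]? = some v := by
      intro z v hz
      rw [pre_getElem?] at hz ⊢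
      split_ifs at hz with h
      rw [if_pos (by omega)]; exact hz
    exact hbad.mono (fun x v => mono _ v) (fun l _ x v => mono _ v)
  · intro W hW
    have hba : ¬ b (2 * encode a) = true := by
      intro h
      simp [H, h] at hW
    have hk : ∃ k, p (a, k) ∧ H a = if b (2 * encode a) = true then none else some (pw k.unpair.2) :=
      ⟨Nat.find (hex a), of_decide_eq_true (Nat.find_spec (hex a)), rfl⟩
    obtain ⟨k, h3, h4⟩ := hk
    rw [hW, if_neg hba] at h4
    have h5 : W = pw k.unpair.2 := Option.some.inj h4
    rcases h3 with h3 | h3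
    · exact absurd h3 hba
    · rw [h5]; exact ⟨k.unpair.1, h3⟩

end S10

end


section
open scoped Classical
open Encodable

namespace S10

theorem pow2_primrec : Primrec (fun n : ℕ => 2 ^ n) := by
  have : Primrec (fun x : ℕ => (x.rec 1 (fun _ r => r * 2) : ℕ)) :=
    Primrec.nat_rec' (h := fun _ (q : ℕ × ℕ) => q.2 * 2) Primrec.id (Primrec.const _)
      (Primrec.nat_mul.comp (Primrec.snd.comp Primrec.snd) (Primrec.const 2))
  refine this.of_eq (fun x => ?_)
  induction x with
  | zero => rfl
  | succ x ih => simp only [pow_succ, ← ih]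

theorem RC.foldl {α σ : Type} [Primcodable α] [Primcodable σ] {O : ℕ → ℕ} {f : α × σ × Bool → σ}
    (hf : RC O f) : RC O (fun q : α × σ × List Bool => q.2.2.foldl (fun s b => f (q.1, s, b)) q.2.1) := by
  let step : α × σ × List Bool → α × σ × List Bool := fun r => (r.1, f (r.1, r.2.1, r.2.2.headI), r.2.2.tail)
  have hstep : RC O step := by
    refine RC.pair (RC.of_primrec Primrec.fst) (RC.pair (RC.comp hf (RC.of_primrec ?_)) (RC.of_primrec ?_))
    · exact Primrec.fst.pair ((Primrec.fst.comp Primrec.snd).pair (Primrec.list_headI.comp (Primrec.snd.comp Primrec.snd)))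
    · exact Primrec.list_tail.comp (Primrec.snd.comp Primrec.snd)
  have h1 : RC O (fun q : α × σ × List Bool => (step^[q.2.2.length] q).2.1) := by
    have h2 : RC O (fun q : α × σ × List Bool => (q, q.2.2.length)) :=
      RC.of_primrec (Primrec.id.pair (Primrec.list_length.comp (Primrec.snd.comp Primrec.snd)))
    have h3 : Primrec (fun q : α × σ × List Bool => q.2.1) := Primrec.fst.comp Primrec.snd
    have h4 := RC.comp (RC.iterate hstep) h2
    have h5 := RC.comp (RC.of_primrec (O := O) h3) h4
    exact h5
  refine h1.of_eq ?_
  rintro ⟨a, s, l⟩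
  simp only
  induction l generalizing s with
  | nil => rfl
  | cons b l ih =>
    simp only [List.length_cons, Function.iterate_succ_apply, List.foldl_cons]
    exact ih _

/-- Horner sum -/
def hor (f : ℕ → ℕ) : ℕ → ℕ
  | 0 => 0
  | n+1 => 2 * hor f n + f n

theorem hor_add (f g e : ℕ → ℕ) (n : ℕ) (h : ∀ i < n, f i + g i = 2 * e i) : hor f n + hor g n = 2 * hor e n := by
  induction n with
  | zero => rfl
  | succ n ih =>
    have h1 := ih (fun i hi => h i (by omega))
    have h2 := h n (by omega)
    simp only [hor]; omega

theorem hor_ge (f : ℕ → ℕ) (n P : ℕ) (h : P < n) : f P * 2 ^ n ≤ hor f n * 2 ^ (P+1) := by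
  induction n with
  | zero => omega
  | succ n ih =>
    rcases Nat.lt_succ_iff_lt_or_eq.1 h with h | rfl
    · have := ih h
      simp only [hor]
      have e1 : f P * 2 ^ (n+1) = 2 * (f P * 2^n) := by ring
      have e2 : (2 * hor f n + f n) * 2 ^ (P+1) = 2 * (hor f n * 2^(P+1)) + f n * 2^(P+1) := by ring
      rw [e1, e2]; omega
    · simp only [hor]
      exact Nat.mul_le_mul_right _ (by omega)

theorem RC.hor {α : Type} [Primcodable α] {O : ℕ → ℕ} {f : α × ℕ → ℕ}
    (hf : RC O f) : RC O (fun q : α × ℕ => S10.hor (fun i => f (q.1, i)) q.2) := by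
  let step : α × ℕ × ℕ → α × ℕ × ℕ := fun r => (r.1, r.2.1 + 1, 2 * r.2.2 + f (r.1, r.2.1))
  have hstep : RC O step := by
    refine RC.pair (RC.of_primrec Primrec.fst) (RC.pair (RC.of_primrec ?_) ?_)
    · exact Primrec.succ.comp (Primrec.fst.comp Primrec.snd)
    · have h1 : RC O (fun p : ℕ × ℕ => 2 * p.1 + p.2) :=
        RC.of_primrec (Primrec.nat_add.comp (Primrec.nat_mul.comp (Primrec.const 2) Primrec.fst) Primrec.snd)
      exact RC.comp h1 (RC.pair (RC.of_primrec (Primrec.snd.comp Primrec.snd)) 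
        (RC.comp hf (RC.of_primrec (Primrec.fst.pair (Primrec.fst.comp Primrec.snd)))))
  have h1 : RC O (fun q : α × ℕ => (step^[q.2] (q.1, 0, 0)).2.2) := by
    have h2 : RC O (fun q : α × ℕ => ((q.1, (0:ℕ), (0:ℕ)), q.2)) :=
      RC.of_primrec ((Primrec.fst.pair (Primrec.const (0, 0))).pair Primrec.snd)
    have h3 : Primrec (fun q : α × ℕ × ℕ => q.2.2) := Primrec.snd.comp Primrec.snd
    have h4 := RC.comp (RC.iterate hstep) h2
    have h5 := RC.comp (RC.of_primrec (O := O) h3) h4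
    exact h5
  refine h1.of_eq ?_
  rintro ⟨a, n⟩
  have : step^[n] (a, 0, 0) = (a, n, S10.hor (fun i => f (a, i)) n) := by
    induction n with
    | zero => rfl
    | succ n ih => rw [Function.iterate_succ_apply', ih]; rfl
  simp [this]

theorem fred_of {α β : Type} [Primcodable α] [Encodable β] {f : α → β} {S : Set ℕ}
    (h : RC (chi S) (fun a => encode (f a))) : FRed f S := by
  have := h.fnOracle
  refine RecIn.of_eq this (fun n => ?_)
  unfold fnOracle
  cases (decode n : Option α) <;> rfl

theorem RC.rat {O : ℕ → ℕ} : RC O (fun q : ℕ × ℕ => encode ((q.1 : ℚ) / 2 ^ q.2)) := by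
  have hp : Primrec (fun r : (ℕ × ℕ) × ℕ => decide (0 < r.2 ∧ (r.1.1 * r.2) % 2 ^ r.1.2 = 0)) := by
    refine PrimrecPred.decide (PrimrecPred.and (Primrec.nat_lt.comp (Primrec.const 0) Primrec.snd) (Primrec.eq.comp ?_ (Primrec.const 0)))
    exact Primrec.nat_mod.comp (Primrec.nat_mul.comp (Primrec.fst.comp Primrec.fst) Primrec.snd) (pow2_primrec.comp (Primrec.snd.comp Primrec.fst))
  have hex : ∀ q : ℕ × ℕ, ∃ d, decide (0 < d ∧ (q.1 * d) % 2 ^ q.2 = 0) = true := fun q => ⟨2 ^ q.2, by simp⟩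
  have hf := RC.find (RC.of_primrec (O := O) hp) hex
  have hden : ∀ q : ℕ × ℕ, Nat.find (hex q) = ((q.1 : ℚ) / 2 ^ q.2).den := by
    rintro ⟨N, l⟩
    rw [Nat.find_eq_iff]
    set x : ℚ := (N : ℚ) / 2 ^ l with hx
    have h2 : (2 : ℚ) ^ l ≠ 0 := by positivity
    refine ⟨?_, ?_⟩
    · simp only [decide_eq_true_eq]
      refine ⟨x.den_pos, ?_⟩
      apply Nat.mod_eq_zero_of_dvd
      have h3 : (N : ℚ) * x.den = x.num * 2 ^ l := by
        have h4 : x * x.den = x.num := Rat.mul_den_eq_num x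
        rw [← h4, hx]; field_simp
      have h5 : ((N * x.den : ℕ) : ℤ) = x.num * ((2 ^ l : ℕ) : ℤ) := by
        have : (((N * x.den : ℕ) : ℤ) : ℚ) = ((x.num * ((2 ^ l : ℕ) : ℤ) : ℤ) : ℚ) := by
          push_cast; exact h3
        exact_mod_cast this
      exact Int.natCast_dvd_natCast.1 ⟨x.num, by rw [h5]; ring⟩
    · intro d hd h
      simp only [decide_eq_true_eq] at h
      obtain ⟨k, hk⟩ := Nat.dvd_of_mod_eq_zero h.2
      have hd0 : (d : ℚ) ≠ 0 := by have := h.1; positivity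
      have h3 : x = ((k : ℤ) : ℚ) / ((d : ℤ) : ℚ) := by
        have h4 : (N : ℚ) * d = 2 ^ l * k := by exact_mod_cast hk
        push_cast
        rw [hx, div_eq_div_iff h2 hd0, h4]; ring
      have h5 := Rat.den_dvd (k : ℤ) (d : ℤ)
      rw [Rat.divInt_eq_div, ← h3] at h5
      have := Nat.le_of_dvd h.1 (Int.natCast_dvd_natCast.1 h5)
      omega
  have hg : Primrec (fun r : (ℕ × ℕ) × ℕ => Nat.pair (2 * (r.1.1 * r.2 / 2 ^ r.1.2)) r.2) := by
    refine Primrec₂.natPair.comp (Primrec.nat_mul.comp (Primrec.const 2) (Primrec.nat_div.comp ?_ ?_)) Primrec.snd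
    · exact Primrec.nat_mul.comp (Primrec.fst.comp Primrec.fst) Primrec.snd
    · exact pow2_primrec.comp (Primrec.snd.comp Primrec.fst)
  have := RC.comp (RC.of_primrec hg) (RC.pair (RC.of_primrec Primrec.id) (hf.of_eq hden))
  refine this.of_eq ?_
  rintro ⟨N, l⟩
  simp only [id]
  set x : ℚ := (N : ℚ) / 2 ^ l with hx
  have h2 : (2 : ℚ) ^ l ≠ 0 := by positivity
  have h3 : (N : ℚ) * x.den = x.num * 2 ^ l := by
    have h4 : x * x.den = x.num := Rat.mul_den_eq_num x
    rw [← h4, hx]; field_simp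
  have h0 : 0 ≤ x := by positivity
  obtain ⟨n, hn⟩ := Int.eq_ofNat_of_zero_le (Rat.num_nonneg.2 h0)
  have h6 : N * x.den = n * 2 ^ l := by
    rw [hn] at h3
    exact_mod_cast h3
  have h7 : N * x.den / 2 ^ l = n := by rw [h6]; exact Nat.mul_div_cancel _ (by positivity)
  rw [h7]
  show _ = Nat.pair (encode x.num) x.den
  rw [hn]; rfl

section
variable (H : ℕ → ℕ → Option (ℕ × Bool))

/-- one betting step -/
def bstep (q : ℕ × (ℕ × ℕ × ℕ) × Bool) : ℕ × ℕ × ℕ :=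
  if ((H q.1 q.2.1.2.1).map Prod.fst) = some q.2.1.1 then
    (q.2.1.1 + 1, q.2.1.1 + 1, if ((H q.1 q.2.1.2.1).map Prod.snd) = some q.2.2 then 2 * q.2.1.2.2 else 0)
  else (q.2.1.1 + 1, q.2.1.2.1, q.2.1.2.2)

/-- state after a string -/
def bst (P : ℕ) (τ : List Bool) : ℕ × ℕ × ℕ := τ.foldl (fun s b => bstep H (P, s, b)) (0, P, 1)

/-- numerator -/
def mnum (τ : List Bool) : ℕ := 1 + hor (fun P => (bst H P τ).2.2) τ.length

/-- the martingale -/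
def mart (τ : List Bool) : ℚ := (mnum H τ : ℚ) / 2 ^ τ.length

variable {H}

theorem bst_append (P : ℕ) (τ : List Bool) (b : Bool) : bst H P (τ ++ [b]) = bstep H (P, bst H P τ, b) := by
  simp [bst]

theorem bst_fst (P : ℕ) (τ : List Bool) : (bst H P τ).1 = τ.length := by
  induction τ using List.reverseRecOn with
  | nil => rfl
  | append_singleton τ b ih =>
    rw [bst_append]; unfold bstep
    split_ifs <;> simp [ih]

theorem bst_fair (P : ℕ) (τ : List Bool) :
    (bst H P (τ ++ [false])).2.2 + (bst H P (τ ++ [true])).2.2 = 2 * (bst H P τ).2.2 := by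
  rw [bst_append, bst_append]
  unfold bstep
  simp only
  cases hH : H P (bst H P τ).2.1 with
  | none => simp; omega
  | some r =>
    obtain ⟨m, q⟩ := r
    simp only [Option.map_some]
    by_cases h : some m = some (bst H P τ).1
    · rw [if_pos h, if_pos h]
      cases q <;> simp
    · rw [if_neg h, if_neg h]; simp; omega

theorem bst_small (hmono : ∀ P n m q, H P n = some (m, q) → n ≤ m) (P : ℕ) (τ : List Bool) (h : τ.length ≤ P) :
    bst H P τ = (τ.length, P, 1) := by
  induction τ using List.reverseRecOn with
  | nil => rfl
  | append_singleton τ b ih =>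
    simp only [List.length_append, List.length_singleton] at h
    rw [bst_append, ih (by omega)]
    unfold bstep
    rw [if_neg]
    · simp
    · simp only
      intro h1
      rw [Option.map_eq_some_iff] at h1
      obtain ⟨⟨m, q⟩, h2, h3⟩ := h1
      have := hmono _ _ _ _ h2
      simp at h3; omega

theorem mart_isMartingale (hmono : ∀ P n m q, H P n = some (m, q) → n ≤ m) : IsMartingale (mart H) := by
  refine ⟨fun σ => by unfold mart; positivity, fun σ => ?_⟩
  have h1 := hor_add _ _ _ σ.length (fun P _ => bst_fair (H := H) P σ)
  have h2 := bst_fair (H := H) σ.length σ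
  rw [bst_small hmono σ.length σ le_rfl] at h2
  have h3 : mnum H (σ ++ [false]) + mnum H (σ ++ [true]) = 4 * mnum H σ := by
    simp only [mnum, List.length_append, List.length_singleton, hor]
    simp only at h2
    omega
  unfold mart
  have h4 : (mnum H (σ ++ [false]) : ℚ) + mnum H (σ ++ [true]) = 4 * mnum H σ := by exact_mod_cast h3
  simp only [List.length_append, List.length_singleton]
  rw [← add_div, h4, pow_succ]
  field_simp
  ring

theorem mart_FRed (hH : RC (chi K) (fun q : ℕ × ℕ => H q.1 q.2)) : FRed (mart H) K := by
  apply fred_of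
  have hb : RC (chi K) (bstep H) := by
    have g : Primrec (fun r : (ℕ × (ℕ × ℕ × ℕ) × Bool) × Option (ℕ × Bool) => 
      if (r.2.map Prod.fst) = some r.1.2.1.1 then
        (r.1.2.1.1 + 1, r.1.2.1.1 + 1, if (r.2.map Prod.snd) = some r.1.2.2 then 2 * r.1.2.1.2.2 else 0)
      else (r.1.2.1.1 + 1, r.1.2.1.2.1, r.1.2.1.2.2)) := by
      have k0 : Primrec (fun r : (ℕ × (ℕ × ℕ × ℕ) × Bool) × Option (ℕ × Bool) => r.1.2.1) :=
        Primrec.fst.comp (Primrec.snd.comp Primrec.fst)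
      have k1 := Primrec.fst.comp k0
      have k2 := Primrec.fst.comp (Primrec.snd.comp k0)
      have k3 := Primrec.snd.comp (Primrec.snd.comp k0)
      have k4 : Primrec (fun r : (ℕ × (ℕ × ℕ × ℕ) × Bool) × Option (ℕ × Bool) => r.1.2.2) :=
        Primrec.snd.comp (Primrec.snd.comp Primrec.fst)
      have k5 : Primrec (fun r : (ℕ × (ℕ × ℕ × ℕ) × Bool) × Option (ℕ × Bool) => r.2.map Prod.fst) :=
        Primrec.option_map Primrec.snd (Primrec.fst.comp Primrec.snd)
      have k6 : Primrec (fun r : (ℕ × (ℕ × ℕ × ℕ) × Bool) × Option (ℕ × Bool) => r.2.map Prod.snd) :=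
        Primrec.option_map Primrec.snd (Primrec.snd.comp Primrec.snd)
      refine Primrec.ite (Primrec.eq.comp k5 (Primrec.option_some.comp k1)) ?_ ?_
      · refine (Primrec.succ.comp k1).pair ((Primrec.succ.comp k1).pair ?_)
        exact Primrec.ite (Primrec.eq.comp k6 (Primrec.option_some.comp k4)) (Primrec.nat_mul.comp (Primrec.const 2) k3) (Primrec.const 0)
      · exact (Primrec.succ.comp k1).pair (k2.pair k3)
    have g2 : RC (chi K) (fun q : ℕ × (ℕ × ℕ × ℕ) × Bool => H q.1 q.2.1.2.1) :=
      RC.comp hH (RC.of_primrec (Primrec.fst.pair (Primrec.fst.comp (Primrec.snd.comp (Primrec.fst.comp Primrec.snd)))))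
    exact (RC.comp (RC.of_primrec g) (RC.pair (RC.of_primrec Primrec.id) g2)).of_eq (fun _ => rfl)
  have h1 : RC (chi K) (fun q : List Bool × ℕ => (bst H q.2 q.1).2.2) := by
    have a1 : RC (chi K) (fun q : List Bool × ℕ => (q.2, ((0:ℕ), q.2, (1:ℕ)), q.1)) :=
      RC.of_primrec (Primrec.snd.pair (((Primrec.const 0).pair (Primrec.snd.pair (Primrec.const 1))).pair Primrec.fst))
    have a2 : Primrec (fun s : ℕ × ℕ × ℕ => s.2.2) := Primrec.snd.comp Primrec.snd
    have h4 := RC.comp (RC.foldl hb) a1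
    have h5 := RC.comp (RC.of_primrec (O := chi K) a2) h4
    exact h5
  have h2 : RC (chi K) (mnum H) := by
    have a1 : RC (chi K) (fun τ : List Bool => (τ, τ.length)) := RC.of_primrec (Primrec.id.pair Primrec.list_length)
    have a2 : Primrec (fun n : ℕ => 1 + n) := Primrec.nat_add.comp (Primrec.const 1) Primrec.id
    have h4 := RC.comp (RC.hor h1) a1
    have h5 := RC.comp (RC.of_primrec (O := chi K) a2) h4
    exact h5
  have h6 := RC.comp (RC.rat (O := chi K)) (RC.pair h2 (RC.of_primrec Primrec.list_length))
  exact h6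

theorem seg_succ (B : Set ℕ) (n : ℕ) : seg B (n+1) = seg B n ++ [decide (n ∈ B)] := by
  simp [seg, List.range_succ]

theorem mart_succeeds (hmono : ∀ P n m q, H P n = some (m, q) → n ≤ m) (B : Set ℕ) (hB : ¬ Succeeds (mart H) B)
    (P : ℕ) : ∃ n ≥ P, H P n = none ∨ ∃ m q, H P n = some (m, q) ∧ decide (m ∈ B) ≠ q := by
  by_contra hcon
  push Not at hcon
  have hall : ∀ n ≥ P, ∃ m, H P n = some (m, decide (m ∈ B)) := by
    intro n hn
    obtain ⟨h1, h2⟩ := hcon n hn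
    obtain ⟨⟨m, q⟩, h3⟩ := Option.ne_none_iff_exists'.1 h1
    exact ⟨m, by rw [h3, h2 m q h3]⟩
  have grow : ∀ j, ∃ x t v, x ≤ t ∧ P ≤ t ∧ bst H P (seg B x) = (x, t, v) ∧ 2 ^ j ≤ v := by
    intro j
    induction j with
    | zero => exact ⟨0, P, 1, by omega, le_rfl, rfl, le_rfl⟩
    | succ j ih =>
      obtain ⟨x, t, v, h1, h2, h3, h4⟩ := ih
      obtain ⟨m, hm⟩ := hall t h2
      have htm := hmono _ _ _ _ hm
      have hk : ∀ k, x + k ≤ m → bst H P (seg B (x + k)) = (x + k, t, v) := by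
        intro k
        induction k with
        | zero => intro _; exact h3
        | succ k ihk =>
          intro hk
          rw [← add_assoc, seg_succ, bst_append, ihk (by omega)]
          unfold bstep
          rw [if_neg]
          simp [hm]; omega
      have hkm := hk (m - x) (by omega)
      have e : x + (m - x) = m := by omega
      rw [e] at hkm
      refine ⟨m+1, m+1, 2*v, le_rfl, by omega, ?_, ?_⟩
      · rw [seg_succ, bst_append, hkm]
        unfold bstep
        simp [hm]
      · rw [pow_succ]; omega
  apply hB
  intro q
  obtain ⟨j, hj⟩ := exists_nat_gt (q * 2 ^ (P+1))
  obtain ⟨x, t, v, h1, h2, h3, h4⟩ := grow (j+1)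
  refine ⟨x, ?_⟩
  have hPx : P < x := by
    by_contra h
    have := bst_small hmono P (seg B x) (by rw [seg_length]; omega)
    rw [h3] at this
    simp only [Prod.mk.injEq] at this
    have h5 : 2 ^ 1 ≤ 2 ^ (j+1) := Nat.pow_le_pow_right (by norm_num) (by omega)
    omega
  have h5 := hor_ge (fun P => (bst H P (seg B x)).2.2) x P hPx
  simp only [h3] at h5
  have h6 : v * 2 ^ x ≤ mnum H (seg B x) * 2 ^ (P+1) := by
    refine h5.trans (Nat.mul_le_mul_right _ ?_)
    simp [mnum, seg_length]
  have h7 : (v : ℚ) * 2 ^ x ≤ mnum H (seg B x) * 2 ^ (P+1) := by exact_mod_cast h6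
  have h8 : (j : ℚ) < v := by
    have : j < v := lt_of_lt_of_le (Nat.lt_two_pow_self.trans (Nat.pow_lt_pow_right (by norm_num) (by omega))) h4
    exact_mod_cast this
  unfold mart
  rw [seg_length, lt_div_iff₀ (by positivity)]
  have h9 : q * 2 ^ x * 2 ^ (P+1) < mnum H (seg B x) * 2 ^ (P+1) := by
    calc q * 2 ^ x * 2 ^ (P+1) = (q * 2 ^ (P+1)) * 2 ^ x := by ring
      _ < v * 2 ^ x := by
        apply mul_lt_mul_of_pos_right (hj.trans h8) (by positivity)
      _ ≤ _ := h7
  exact lt_of_mul_lt_mul_right h9 (by positivity)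
end

end S10

end


section
open scoped Classical
open Encodable
open Nat.Partrec (Code)

namespace S10

/-- forcing conditions -/
structure Cnd where
  st : Bool → List Bool
  L : List (ℕ × Bool)

def XL (D : ℕ → Bool) (L : List (ℕ × Bool)) : Set ℕ := {x | ∀ l ∈ L, D (Nat.pair l.1 x) = l.2}

def Good (A : Set ℕ) (D : ℕ → Bool) (p : Cnd) : Prop :=
  (∀ (i : Bool) (x : ℕ), (p.st i)[x]? = some true → decide (x ∈ A) = i) ∧ (XL D p.L).Infinite

def Ext (D : ℕ → Bool) (q p : Cnd) : Prop :=
  (∀ i, p.st i <+: q.st i) ∧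
  (∀ (i : Bool) (x : ℕ), (p.st i).length ≤ x → (q.st i)[x]? = some true → x ∈ XL D p.L) ∧ XL D q.L ⊆ XL D p.L

theorem prefix_get {σ τ : List Bool} (h : σ <+: τ) {x : ℕ} (hx : x < σ.length) : τ[x]? = σ[x]? := by
  obtain ⟨ρ, rfl⟩ := h
  rw [List.getElem?_append_left hx]

theorem Ext.refl (D : ℕ → Bool) (p : Cnd) : Ext D p p := by
  refine ⟨fun i => List.prefix_rfl, fun i x h1 h2 => ?_, subset_rfl⟩
  rw [List.getElem?_eq_none h1] at h2; cases h2

theorem Ext.trans {D : ℕ → Bool} {r q p : Cnd} (h1 : Ext D r q) (h2 : Ext D q p) : Ext D r p := by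
  refine ⟨fun i => (h2.1 i).trans (h1.1 i), fun i x h3 h4 => ?_, h1.2.2.trans h2.2.2⟩
  by_cases h : x < (q.st i).length
  · rw [prefix_get (h1.1 i) h] at h4
    exact h2.2.1 i x h3 h4
  · exact h2.2.2 (h1.2.1 i x (by omega) h4)

def Compat (D : ℕ → Bool) (q : Cnd) (i : Bool) (S : Set ℕ) : Prop :=
  (∀ x < (q.st i).length, (q.st i)[x]? = some (decide (x ∈ S))) ∧
  ∀ x, (q.st i).length ≤ x → x ∈ S → x ∈ XL D q.L

def OutI (D : ℕ → Bool) (B : Set ℕ) (p q : Cnd) (i : Bool) (e : Code) (c : Bool) : Prop :=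
  (∃ m, (p.st i).length ≤ m ∧ decide (m ∈ B) ≠ c ∧ ∃ s r, Enum e s ((q.st i).take r) m) ∨
  (∃ n, ∀ S, Compat D q i S → ∀ m s k, Enum e s (seg S k) m → m < n)

theorem extend {A : Set ℕ} {D : ℕ → Bool} {p : Cnd} (hp : Good A D p) (i : Bool) (ρ : List Bool)
    (h1 : p.st i <+: ρ)
    (h2 : ∀ x : ℕ, (p.st i).length ≤ x → ρ[x]? = some true → x ∈ XL D p.L ∧ decide (x ∈ A) = i) :
    ∃ q, Good A D q ∧ Ext D q p ∧ q.st i = ρ := by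
  refine ⟨⟨Function.update p.st i ρ, p.L⟩, ⟨fun j x hx => ?_, hp.2⟩, ⟨fun j => ?_, fun j x hx hx2 => ?_, subset_rfl⟩, ?_⟩
  · by_cases hj : j = i
    · subst hj
      simp only [Function.update_self] at hx
      by_cases h : x < (p.st j).length
      · rw [prefix_get h1 h] at hx
        exact hp.1 j x hx
      · exact (h2 x (by omega) hx).2
    · simp only [Function.update_of_ne hj] at hx
      exact hp.1 j x hx
  · by_cases hj : j = i
    · subst hj; simpa using h1
    · simp [Function.update_of_ne hj]
  · by_cases hj : j = i
    · subst hj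
      simp only [Function.update_self] at hx2
      exact (h2 x hx hx2).1
    · simp only [Function.update_of_ne hj] at hx2
      rw [List.getElem?_eq_none hx] at hx2; cases hx2
  · simp

theorem addOne {A : Set ℕ} {D : ℕ → Bool} {p : Cnd} (hp : Good A D p) (i : Bool) (x : ℕ)
    (h1 : (p.st i).length ≤ x) (h2 : x ∈ XL D p.L) (h3 : decide (x ∈ A) = i) :
    ∃ q, Good A D q ∧ Ext D q p ∧ (q.st i)[x]? = some true := by
  have key : ∀ y : ℕ, (p.st i).length ≤ y →
      (p.st i ++ (List.replicate (x - (p.st i).length) false ++ [true]))[y]? = some true → y = x := by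
    intro y hy h
    rw [List.getElem?_append_right hy] at h
    by_cases hyx : y - (p.st i).length < x - (p.st i).length
    · rw [List.getElem?_append_left (by simpa using hyx), List.getElem?_replicate, if_pos hyx] at h
      simp at h
    · rw [List.getElem?_append_right (by simpa using hyx)] at h
      have := (List.getElem?_eq_some_iff.1 h).1
      simp at this; omega
  obtain ⟨q, h4, h5, h6⟩ := extend hp i _ (List.prefix_append _ (List.replicate (x - (p.st i).length) false ++ [true]))
    (fun y hy hy2 => by rw [key y hy hy2]; exact ⟨h2, h3⟩)
  refine ⟨q, h4, h5, ?_⟩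
  rw [h6, List.getElem?_append_right h1, List.getElem?_append_right (by simp)]
  simp

/-- what the martingale gives us -/
def Wins (A B : Set ℕ) (D : ℕ → Bool) : Prop :=
  ∀ P : Par, ∃ n, encode P ≤ n ∧ ((∀ N W, ¬ Bad (encode (P, n)) (P, n) (pre D N) W) ∨
    ∃ W : Wit, (∃ N, Bad (encode (P, n)) (P, n) (pre (sub D A (encode (P, n))) N) W) ∧
      decide (W.2.2.1 ∈ B) ≠ po P.2.2.2 W.1)

theorem key {A B : Set ℕ} {D : ℕ → Bool} (hw : Wins A B D) {p : Cnd} (hp : Good A D p)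
    (r : (Code × Code) × (Bool × Bool)) :
    ∃ q, Good A D q ∧ Ext D q p ∧ ∃ i, OutI D B p q i (cdd r.1 i) (po r.2 i) := by
  obtain ⟨n, hn, h⟩ := hw ((p.st true, p.st false), p.L, r.1, r.2)
  have hsg : ∀ i, sg (p.st true, p.st false) i = p.st i := by intro i; cases i <;> rfl
  have hlen : ∀ i, (p.st i).length ≤ n := fun i => by
    have := sg_le_encode ((p.st true, p.st false), p.L, r.1, r.2) i
    simp only [hsg] at this
    exact this.trans hn
  have hLlt : ∀ l ∈ p.L, l.1 < encode ((((p.st true, p.st false), p.L, r.1, r.2), n) : Par × ℕ) :=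
    fun l hl => encode_L_lt (a := (((p.st true, p.st false), p.L, r.1, r.2), n)) hl
  generalize hc : encode ((((p.st true, p.st false), p.L, r.1, r.2), n) : Par × ℕ) = c at h hLlt
  rcases h with h | ⟨W, ⟨N, hN⟩, hW⟩
  · -- no witness
    have hinf : ∃ i, (XL D ((c, i) :: p.L)).Infinite := by
      by_contra hcon
      push Not at hcon
      apply hp.2
      refine ((Set.not_infinite.1 (by simpa using hcon true)).union (Set.not_infinite.1 (by simpa using hcon false))).subset ?_
      intro x hx
      cases hD : D (Nat.pair c x)
      · right; intro l hl
        rcases List.mem_cons.1 hl with rfl | hl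
        · exact hD
        · exact hx l hl
      · left; intro l hl
        rcases List.mem_cons.1 hl with rfl | hl
        · exact hD
        · exact hx l hl
    obtain ⟨i, hi⟩ := hinf
    have hsub : XL D ((c, i) :: p.L) ⊆ XL D p.L := fun x hx l hl => hx l (List.mem_cons_of_mem _ hl)
    refine ⟨⟨p.st, (c, i) :: p.L⟩, ⟨hp.1, hi⟩, ⟨fun i => List.prefix_rfl, (Ext.refl D p).2.1, hsub⟩, i, Or.inr ⟨n, ?_⟩⟩
    intro S hS m s k hE
    by_contra hm
    refine h (Nat.pair c k) (i, seg S k, m, s) ⟨by simpa using hm, hE, fun x hx => ?_⟩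
    simp only [hsg]
    simp only [seg_length] at hx
    rw [seg_getElem?, if_pos hx]
    refine ⟨fun h1 => (hS.1 x h1).symm, fun h1 h2 => ?_⟩
    have hxS : x ∈ S := by simpa using h2
    have hxX := hS.2 x h1 hxS
    have hlt : Nat.pair c x < Nat.pair c k := Nat.pair_lt_pair_right c hx
    constructor
    · rw [pre_getElem?, if_pos hlt]
      exact congrArg some (hxX (c, i) List.mem_cons_self)
    · intro l hl
      rw [pre_getElem?, if_pos ((Nat.pair_lt_pair_left x (hLlt l hl)).trans hlt)]
      exact congrArg some (hxX l (List.mem_cons_of_mem _ hl))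
  · obtain ⟨i, ρ, m, s⟩ := W
    obtain ⟨h1, h2, h3⟩ := hN
    simp only [hsg] at h1 h2 h3 hW
    have h4 : ∀ x : ℕ, (p.st i).length ≤ x → ρ[x]? = some true → x ∈ XL D p.L ∧ decide (x ∈ A) = i := by
      intro x hx hx2
      obtain ⟨h5, h6⟩ := (h3 x (List.getElem?_eq_some_iff.1 hx2).1).2 hx hx2
      rw [pre_getElem?] at h5
      constructor
      · intro l hl
        have h7 := h6 l hl
        rw [pre_getElem?] at h7
        split_ifs at h7
        have hne := (hLlt l hl).ne
        simpa [sub, hne] using h7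
      · split_ifs at h5
        simpa [sub] using h5
    by_cases hl : (p.st i).length ≤ ρ.length
    · have hpre : p.st i <+: ρ := by
        rw [List.prefix_iff_getElem?]
        intro x hx
        rw [(h3 x (by omega)).1 hx, List.getElem?_eq_getElem hx]
      obtain ⟨q, h5, h6, h7⟩ := extend hp i ρ hpre h4
      refine ⟨q, h5, h6, i, Or.inl ⟨m, (hlen i).trans h1, hW, s, ρ.length, ?_⟩⟩
      rw [h7, List.take_length]; exact h2
    · refine ⟨p, hp, Ext.refl D p, i, Or.inl ⟨m, (hlen i).trans h1, hW, s, ρ.length, ?_⟩⟩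
      have : (p.st i).take ρ.length = ρ := by
        apply List.ext_getElem?
        intro x
        rw [List.getElem?_take]
        split_ifs with hx
        · exact ((h3 x hx).1 (by omega)).symm
        · rw [List.getElem?_eq_none (by omega)]
      rw [this]; exact h2

theorem id_code : ∃ e : Code, ∀ (ρ : List Bool) (m : ℕ), (∃ s, Enum e s ρ m) ↔ ρ[m]? = some true := by
  have hc : Primrec (fun q : List Bool × ℕ => if q.1[q.2]? = some true then 1 else 0) :=
    Primrec.ite (Primrec.eq.comp (Primrec.list_getElem?.comp Primrec.fst Primrec.snd) (Primrec.const _)) (Primrec.const 1) (Primrec.const 0)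
  have hc2 : Primrec (fun n : ℕ => (((decode n : Option (List Bool × ℕ)).map (fun q : List Bool × ℕ => if q.1[q.2]? = some true then 1 else 0)).getD 0)) :=
    Primrec.option_getD.comp (Primrec.option_map Primrec.decode (hc.comp Primrec.snd)) (Primrec.const 0)
  obtain ⟨e, he⟩ := Nat.Partrec.Code.exists_code.1 (Partrec.nat_iff.1 hc2.to_comp.partrec)
  refine ⟨e, fun ρ m => ?_⟩
  have h1 : (∃ s, Enum e s ρ m) ↔ 1 ∈ e.eval (encode (ρ, m)) := by
    rw [Nat.Partrec.Code.evaln_complete]; rfl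
  rw [h1, he]
  simp only [PFun.coe_val, Part.mem_some_iff, encodek, Option.map_some, Option.getD_some]
  split_ifs with h <;> simp [h]

def Act (A : Set ℕ) (D : ℕ → Bool) (p : Cnd) (i : Bool) : Prop :=
  ∀ q, Good A D q → Ext D q p → ∃ x, (q.st i).length ≤ x ∧ x ∈ XL D q.L ∧ decide (x ∈ A) = i

def Dead (A : Set ℕ) (D : ℕ → Bool) (p : Cnd) (i : Bool) : Prop :=
  ∀ x, (p.st i).length ≤ x → x ∈ XL D p.L → decide (x ∈ A) ≠ i

theorem start (A : Set ℕ) (D : ℕ → Bool) : ∃ p, Good A D p ∧ ∀ i, Act A D p i ∨ Dead A D p i := by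
  have h0 : Good A D ⟨fun _ => [], []⟩ := by
    refine ⟨fun i x h => by simp at h, ?_⟩
    have : XL D [] = Set.univ := by ext; simp [XL]
    show (XL D []).Infinite
    rw [this]; exact Set.infinite_univ
  by_cases h : ∀ i, Act A D ⟨fun _ => [], []⟩ i
  · exact ⟨_, h0, fun i => Or.inl (h i)⟩
  · push Not at h
    obtain ⟨i, hi⟩ := h
    unfold Act at hi
    push Not at hi
    obtain ⟨p, hp, -, hd⟩ := hi
    refine ⟨p, hp, fun j => ?_⟩
    by_cases hj : j = i
    · subst hj; exact Or.inr hd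
    · left
      intro q hq hqp
      obtain ⟨x, hx, hx2⟩ := hq.2.exists_gt (max (p.st i).length (q.st j).length)
      have := hd x (by omega) (hqp.2.2 hx)
      refine ⟨x, by omega, hx, ?_⟩
      revert this hj
      cases i <;> cases j <;> simp

theorem generic {A : Set ℕ} {D : ℕ → Bool} {p0 : Cnd} (h0 : Good A D p0) (Q : ℕ → Cnd → Cnd → Prop)
    (hQ : ∀ t p, Good A D p → Ext D p p0 → ∃ q, Good A D q ∧ Ext D q p ∧ Q t p q) :
    ∃ f : ℕ → Cnd, ∀ t, Good A D (f t) ∧ Ext D (f t) p0 ∧ Ext D (f (t+1)) (f t) ∧ Q t (f t) (f (t+1)) := by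
  choose g hg1 hg2 hg3 using hQ
  let F : ℕ → {p : Cnd // Good A D p ∧ Ext D p p0} := fun t => Nat.rec ⟨p0, h0, Ext.refl D p0⟩
    (fun t p => ⟨g t p.1 p.2.1 p.2.2, hg1 t p.1 p.2.1 p.2.2, (hg2 t p.1 p.2.1 p.2.2).trans p.2.2⟩) t
  refine ⟨fun t => (F t).1, fun t => ⟨(F t).2.1, (F t).2.2, ?_, ?_⟩⟩
  · exact hg2 t (F t).1 (F t).2.1 (F t).2.2
  · exact hg3 t (F t).1 (F t).2.1 (F t).2.2

theorem ext_le {D : ℕ → Bool} {f : ℕ → Cnd} (h : ∀ t, Ext D (f (t+1)) (f t)) {s t : ℕ} (hst : s ≤ t) :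
    Ext D (f t) (f s) := by
  induction t, hst using Nat.le_induction with
  | base => exact Ext.refl D _
  | succ t _ ih => exact (h t).trans ih

theorem compat_lim {D : ℕ → Bool} {f : ℕ → Cnd} (h : ∀ t, Ext D (f (t+1)) (f t)) (i : Bool) (t : ℕ) :
    Compat D (f t) i {x | ∃ t, ((f t).st i)[x]? = some true} := by
  constructor
  · intro x hx
    obtain ⟨b, hb⟩ : ∃ b, ((f t).st i)[x]? = some b := ⟨_, List.getElem?_eq_getElem hx⟩
    rw [hb]
    cases b
    · symm
      simp only [Set.mem_ofPred_eq, Option.some.injEq, decide_eq_false_iff_not, not_exists]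
      intro u hu
      rcases le_total u t with hut | hut
      · have := getElem?_of_prefix ((ext_le h hut).1 i) hu
        rw [hb] at this; simp at this
      · have := getElem?_of_prefix ((ext_le h hut).1 i) hb
        rw [hu] at this; simp at this
    · symm
      simp only [Set.mem_ofPred_eq, Option.some.injEq, decide_eq_true_eq]
      exact ⟨t, hb⟩
  · rintro x hx ⟨u, hu⟩
    rcases le_total u t with hut | hut
    · have := getElem?_of_prefix ((ext_le h hut).1 i) hu
      rw [List.getElem?_eq_none hx] at this; cases this
    · exact (ext_le h hut).2.1 i x hx hu

theorem take_seg {D : ℕ → Bool} {q : Cnd} {i : Bool} {S : Set ℕ} (h : Compat D q i S) (r : ℕ) :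
    (q.st i).take r = seg S (min r (q.st i).length) := by
  apply List.ext_getElem?
  intro x
  rw [List.getElem?_take, seg_getElem?]
  by_cases h1 : x < r
  · by_cases h2 : x < (q.st i).length
    · rw [if_pos h1, if_pos (by omega), h.1 x h2]
    · rw [if_pos h1, if_neg (by omega), List.getElem?_eq_none (by omega)]
  · rw [if_neg h1, if_neg (by omega)]

theorem main (A B : Set ℕ) (D : ℕ → Bool) (hw : Wins A B D)
    (hred : ∀ S ∈ Hset A, ∃ T ∈ Hset B, TRed T S) : False := by
  obtain ⟨p0, hp0, hAD⟩ := start A D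
  obtain ⟨f, hf⟩ := generic hp0 (fun t p q =>
    (∀ r, (decode t : Option ((Code × Code) × (Bool × Bool))) = some r → ∃ i, OutI D B p q i (cdd r.1 i) (po r.2 i)) ∧
    ∀ i, Act A D p0 i → ∃ x, (p.st i).length ≤ x ∧ (q.st i)[x]? = some true) (by
    intro t p hp hpp
    have add : ∀ (i : Bool) (p : Cnd), Good A D p → Ext D p p0 → ∃ q, Good A D q ∧ Ext D q p ∧
        (Act A D p0 i → ∃ x, (p.st i).length ≤ x ∧ (q.st i)[x]? = some true) := by
      intro i p hp hpp
      by_cases ha : Act A D p0 i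
      · obtain ⟨x, h1, h2, h3⟩ := ha p hp hpp
        obtain ⟨q, h4, h5, h6⟩ := addOne hp i x h1 h2 h3
        exact ⟨q, h4, h5, fun _ => ⟨x, h1, h6⟩⟩
      · exact ⟨p, hp, Ext.refl D p, fun h => absurd h ha⟩
    obtain ⟨p1, g1, e1, a1⟩ := add true p hp hpp
    obtain ⟨p2, g2, e2, a2⟩ := add false p1 g1 (e1.trans hpp)
    have hr : ∃ q, Good A D q ∧ Ext D q p2 ∧ ∀ r, (decode t : Option ((Code × Code) × (Bool × Bool))) = some r → ∃ i, OutI D B p2 q i (cdd r.1 i) (po r.2 i) := by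
      cases hd : (decode t : Option ((Code × Code) × (Bool × Bool))) with
      | none => exact ⟨p2, g2, Ext.refl D p2, fun r hr => by cases hr⟩
      | some r =>
        obtain ⟨q, h1, h2, h3⟩ := key hw g2 r
        exact ⟨q, h1, h2, fun r' hr' => by cases hr'; exact h3⟩
    obtain ⟨q, g3, e3, a3⟩ := hr
    refine ⟨q, g3, e3.trans (e2.trans e1), fun r hr => ?_, fun i hi => ?_⟩
    · obtain ⟨i, hi⟩ := a3 r hr
      refine ⟨i, ?_⟩
      rcases hi with ⟨m, hm, h⟩ | h
      · exact Or.inl ⟨m, (((e2.trans e1).1 i).length_le).trans hm, h⟩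
      · exact Or.inr h
    · cases i
      · obtain ⟨x, h1, h2⟩ := a2 hi
        exact ⟨x, ((e1.1 false).length_le).trans h1, getElem?_of_prefix (e3.1 false) h2⟩
      · obtain ⟨x, h1, h2⟩ := a1 hi
        exact ⟨x, h1, getElem?_of_prefix ((e3.trans e2).1 true) h2⟩)
  have hext : ∀ t, Ext D (f (t+1)) (f t) := fun t => (hf t).2.2.1
  have hside : ∀ i, ∃ (e : Code) (c : Bool), ∀ t, ¬ OutI D B (f t) (f (t+1)) i e c := by
    intro i
    rcases hAD i with ha | hd
    · let S : Set ℕ := {x | ∃ t, ((f t).st i)[x]? = some true}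
      have hcomp : ∀ t, Compat D (f t) i S := fun t => compat_lim hext i t
      have hSA : ∀ x ∈ S, decide (x ∈ A) = i := by
        rintro x ⟨t, ht⟩
        exact (hf t).1.1 i x ht
      have hlen : ∀ t, t ≤ ((f t).st i).length := by
        intro t
        induction t with
        | zero => omega
        | succ t ih =>
          obtain ⟨x, h1, h2⟩ := (hf t).2.2.2.2 i ha
          have := (List.getElem?_eq_some_iff.1 h2).1
          omega
      have hSinf : S.Infinite := by
        refine Set.infinite_of_forall_exists_gt (fun n => ?_)
        obtain ⟨x, h1, h2⟩ := (hf (n+1)).2.2.2.2 i ha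
        have := hlen (n+1)
        exact ⟨x, ⟨_, h2⟩, by omega⟩
      have hSH : S ∈ Hset A := by
        refine ⟨hSinf, ?_⟩
        cases i
        · right; intro x hx; simpa using hSA x hx
        · left; intro x hx; simpa using hSA x hx
      obtain ⟨T, ⟨hTinf, hTB⟩, hTS⟩ := hred S hSH
      obtain ⟨e, he⟩ := exists_enum hTS
      have hc : ∃ c : Bool, ∀ m ∈ T, decide (m ∈ B) = c := by
        rcases hTB with h | h
        · exact ⟨true, fun m hm => by simpa using h hm⟩
        · exact ⟨false, fun m hm => by simpa using h hm⟩
      obtain ⟨c, hc⟩ := hc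
      refine ⟨e, c, fun t hout => ?_⟩
      rcases hout with ⟨m, -, h1, s, r, h2⟩ | ⟨n, h1⟩
      · rw [take_seg (hcomp (t+1))] at h2
        exact h1 (hc m ((he m).2 ⟨s, _, h2⟩))
      · obtain ⟨m, hm, hmn⟩ := hTinf.exists_gt n
        obtain ⟨s, k, h2⟩ := (he m).1 hm
        have := h1 S (hcomp (t+1)) m s k h2
        omega
    · obtain ⟨e, he⟩ := id_code
      refine ⟨e, true, fun t hout => ?_⟩
      rcases hout with ⟨m, hm, -, s, r, h2⟩ | ⟨n, h1⟩
      · have h3 := (he _ _).1 ⟨s, h2⟩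
        rw [List.getElem?_take] at h3
        split_ifs at h3
        have h4 := (hf (t+1)).1.1 i m h3
        have h5 := (hext t).2.1 i m hm h3
        exact hd m (((hf t).2.1.1 i).length_le.trans hm) ((hf t).2.1.2.2 h5) h4
      · let q := f (t+1)
        let S : Set ℕ := {x | (q.st i)[x]? = some true ∨ ((q.st i).length ≤ x ∧ x ∈ XL D q.L)}
        have hS : Compat D q i S := by
          constructor
          · intro x hx
            obtain ⟨b, hb⟩ : ∃ b, (q.st i)[x]? = some b := ⟨_, List.getElem?_eq_getElem hx⟩
            have : x ∈ S ↔ b = true := by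
              simp only [S, Set.mem_ofPred_eq, hb, Option.some.injEq]
              constructor
              · rintro (h | h)
                · exact h
                · omega
              · exact Or.inl
            rw [hb]
            cases b <;> simp [this]
          · rintro x hx (h | h)
            · rw [List.getElem?_eq_none hx] at h; cases h
            · exact h.2
        obtain ⟨m, hm, hmn⟩ := (hf (t+1)).1.2.exists_gt (max n (q.st i).length)
        have hmS : m ∈ S := Or.inr ⟨by omega, hm⟩
        obtain ⟨s, hs⟩ := (he (seg S (m+1)) m).2 (by rw [seg_getElem?, if_pos (by omega)]; simp [hmS])
        have := h1 S hS m s (m+1) hs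
        omega
  choose e c hec using hside
  obtain ⟨i, hi⟩ := (hf (encode ((e true, e false), (c true, c false)))).2.2.2.1 _ (encodek _)
  cases i
  · exact hec false _ hi
  · exact hec true _ hi

theorem final (C : Set (Set ℕ)) (hC : ∀ A ∈ C, TRed A K)
    (hnull : ¬ ∃ M : List Bool → ℚ, IsMartingale M ∧ FRed M K ∧ ∀ A ∈ C, Succeeds M A) :
    ¬ ∃ A ∈ C, ∀ B ∈ C, ∀ S ∈ Hset A, ∃ T ∈ Hset B, TRed T S := by
  rintro ⟨A, hA, hall⟩
  obtain ⟨D, H0, hH0, hbad⟩ := interface A (hC A hA)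
  let pa : ℕ → Par := fun P => (decode P : Option Par).getD default
  let G : ℕ → ℕ → Option (ℕ × Bool) := fun P n =>
    (H0 (pa P, n)).map (fun W => (W.2.2.1, po (pa P).2.2.2 W.1))
  have hmono : ∀ P n m q, G P n = some (m, q) → n ≤ m := by
    intro P n m q h
    simp only [G, Option.map_eq_some_iff] at h
    obtain ⟨W, h1, h2⟩ := h
    obtain ⟨N, hN⟩ := (hbad (pa P, n)).2 W h1
    have := hN.1
    simp only [Prod.mk.injEq] at h2
    simp only at this
    omega
  have hpa : Primrec pa := Primrec.option_getD.comp Primrec.decode (Primrec.const default)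
  have hG : RC (chi K) (fun q : ℕ × ℕ => G q.1 q.2) := by
    have k1 : RC (chi K) (fun q : ℕ × ℕ => H0 (pa q.1, q.2)) :=
      RC.comp hH0 (RC.of_primrec ((hpa.comp Primrec.fst).pair Primrec.snd))
    have kpo : Primrec (fun q : (Bool × Bool) × Bool => po q.1 q.2) :=
      Primrec.cond Primrec.snd (Primrec.fst.comp Primrec.fst) (Primrec.snd.comp Primrec.fst)
    have kp : Primrec (fun q : ℕ × ℕ => (pa q.1).2.2.2) :=
      Primrec.snd.comp (Primrec.snd.comp (Primrec.snd.comp (hpa.comp Primrec.fst)))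
    have k2 : Primrec (fun q : (Bool × Bool) × Option Wit => q.2.map (fun W => (W.2.2.1, po q.1 W.1))) := by
      refine Primrec.option_map Primrec.snd ?_
      exact Primrec.pair (Primrec.fst.comp (Primrec.snd.comp (Primrec.snd.comp Primrec.snd)))
        (kpo.comp ((Primrec.fst.comp Primrec.fst).pair (Primrec.fst.comp Primrec.snd)))
    have k3 := RC.pair (RC.of_primrec (O := chi K) kp) k1
    have k4 := RC.comp (RC.of_primrec (O := chi K) k2) k3
    exact k4
  have hB : ∃ B ∈ C, ¬ Succeeds (mart G) B := by
    by_contra hcon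
    push Not at hcon
    exact hnull ⟨mart G, mart_isMartingale hmono, mart_FRed hG, hcon⟩
  obtain ⟨B, hBC, hB⟩ := hB
  refine main A B D (fun P => ?_) (hall B hBC)
  obtain ⟨n, hn, h⟩ := mart_succeeds hmono B hB (encode P)
  have hpP : pa (encode P) = P := by simp only [pa, encodek, Option.getD_some]
  refine ⟨n, hn, ?_⟩
  simp only [G, hpP] at h
  rcases h with h | ⟨m, q, h1, h2⟩
  · rw [Option.map_eq_none_iff] at h
    exact Or.inl ((hbad (P, n)).1 h)
  · rw [Option.map_eq_some_iff] at h1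
    obtain ⟨W, h3, h4⟩ := h1
    simp only [Prod.mk.injEq] at h4
    refine Or.inr ⟨W, (hbad (P, n)).2 W h3, ?_⟩
    rw [h4.1, h4.2]; exact h2

end S10

end

/-- if `C` is a class of `Δ⁰₂` sets that is not `Δ⁰₂` null, then the
structure `{H(B) : B ∈ C}` under Muchnik reducibility has no largest element. -/
theorem stmt10 (C : Set (Set ℕ)) (hC : ∀ A ∈ C, TRed A K)
    (hnull : ¬ ∃ M : List Bool → ℚ, IsMartingale M ∧ FRed M K ∧ ∀ A ∈ C, Succeeds M A) :
    ¬ ∃ A ∈ C, ∀ B ∈ C, ∀ S ∈ Hset A, ∃ T ∈ Hset B, TRed T S := by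
  exact S10.final C hC hnull
end

section
/- Let M : 2^{<ω} × ℕ → ℚ^{≥0} be a martingale approximation, i.e., for every σ and s, 2M(σ,s) = M(σ0,s) + M(σ1,s), and for every σ the value M(σ,s) is eventually constant in s. Then there exists a function f : ℕ × ℕ → {0,1} computable from M such that lim_s f(x,s) exists for every x, and, writing A = {x : lim_s f(x,s) = 1} and M̃(σ) = lim_s M(σ,s), we have limsup_{n→∞} M̃(A↾n) < ∞; i.e., the limit martingale M̃ does not succeed on the limit set of f. -/
/-!
Preamble: oracle computability, Turing reducibility, the jump, martingales,
and Martin-Löf randomness, developed from scratch.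
-/

open scoped Classical

def Tot (O : ℕ → ℕ) (f : ℕ → ℕ) : Prop := RecIn O (fun n => Part.some (f n))

theorem Tot.comp {O f g} (hf : Tot O f) (hg : Tot O g) : Tot O (fun n => f (g n)) := by
  have h := RecIn.comp hf hg
  unfold Tot
  convert h using 2
  simp

theorem Tot.pair {O f g} (hf : Tot O f) (hg : Tot O g) :
    Tot O (fun n => Nat.pair (f n) (g n)) := by
  have h := RecIn.pair hf hg
  unfold Tot
  convert h using 2
  simp [Seq.seq]

theorem Tot.prec {O f g} (hf : Tot O f) (hg : Tot O g) :
    Tot O (Nat.unpaired fun a n =>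
      n.rec (f a) fun y IH => g (Nat.pair a (Nat.pair y IH))) := by
  have h := RecIn.prec hf hg
  unfold Tot
  refine (congrArg (RecIn O) (funext fun n => ?_)).mpr h
  simp only [Nat.unpaired]
  induction n.unpair.2 with
  | zero => rfl
  | succ k ih => simp only [← ih]; simp

theorem Tot.of_prim {O f} (hf : Nat.Primrec f) : Tot O f := by
  induction hf with
  | zero => exact RecIn.zero
  | succ => exact RecIn.succ
  | left => exact RecIn.left
  | right => exact RecIn.right
  | pair _ _ h1 h2 => exact h1.pair h2
  | comp _ _ h1 h2 => exact h1.comp h2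
  | prec _ _ h1 h2 => exact h1.prec h2

theorem Tot.prim {O f} (hf : Primrec f) : Tot O f := Tot.of_prim (Primrec.nat_iff.1 hf)

/-- comparison of (shifted) codes of nonnegative rationals -/
def cmpc (a b : ℕ) : Bool :=
  decide (((a - 1).unpair.1 / 2) * (b - 1).unpair.2 ≤ ((b - 1).unpair.1 / 2) * (a - 1).unpair.2)

theorem encode_rat (q : ℚ) (hq : 0 ≤ q) :
    Encodable.encode q = Nat.pair (2 * q.num.toNat) q.den := by
  obtain ⟨n, d, h1, h2⟩ := q
  have hn : 0 ≤ n := Rat.num_nonneg.mpr hq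
  lift n to ℕ using hn
  rfl

theorem cmpc_spec (p q : ℚ) (hp : 0 ≤ p) (hq : 0 ≤ q) :
    cmpc (Encodable.encode p + 1) (Encodable.encode q + 1) = decide (p ≤ q) := by
  unfold cmpc
  rw [encode_rat p hp, encode_rat q hq]
  simp only [Nat.add_sub_cancel, Nat.unpair_pair]
  rw [Nat.mul_div_cancel_left _ (by norm_num), Nat.mul_div_cancel_left _ (by norm_num)]
  apply Bool.decide_congr
  rw [Rat.le_iff]
  have h1 : ((p.num.toNat : ℕ) : ℤ) = p.num := Int.toNat_of_nonneg (Rat.num_nonneg.mpr hp)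
  have h2 : ((q.num.toNat : ℕ) : ℤ) = q.num := Int.toNat_of_nonneg (Rat.num_nonneg.mpr hq)
  rw [← h1, ← h2]
  norm_cast

theorem cmpc_prim : Primrec₂ cmpc := by
  have hu1 : Primrec fun n : ℕ => n.unpair.1 := Primrec.fst.comp Primrec.unpair
  have hu2 : Primrec fun n : ℕ => n.unpair.2 := Primrec.snd.comp Primrec.unpair
  have hs : Primrec fun n : ℕ => n - 1 := Primrec.pred
  have hn : Primrec fun n : ℕ => (n - 1).unpair.1 / 2 :=
    Primrec.nat_div.comp (hu1.comp hs) (Primrec.const 2)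
  have hd : Primrec fun n : ℕ => (n - 1).unpair.2 := hu2.comp hs
  have := Primrec.nat_le.comp
    (Primrec.nat_mul.comp (hn.comp (Primrec.fst (α := ℕ) (β := ℕ))) (hd.comp Primrec.snd))
    (Primrec.nat_mul.comp (hn.comp (Primrec.snd (α := ℕ) (β := ℕ))) (hd.comp Primrec.fst))
  exact this.decide

def appc (b : Bool) (n : ℕ) : ℕ :=
  Encodable.encode (((Encodable.decode n : Option (List Bool)).getD []) ++ [b])

theorem appc_spec (b : Bool) (l : List Bool) :
    appc b (Encodable.encode l) = Encodable.encode (l ++ [b]) := by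
  simp [appc]

theorem appc_prim (b : Bool) : Primrec (appc b) := by
  have h1 : Primrec fun n : ℕ => (Encodable.decode n : Option (List Bool)).getD [] :=
    Primrec.option_getD.comp Primrec.decode (Primrec.const [])
  exact Primrec.encode.comp (Primrec.list_append.comp h1 (Primrec.const [b]))

def sig (M : List Bool × ℕ → ℚ) (s : ℕ) : ℕ → List Bool
  | 0 => []
  | n + 1 => sig M s n ++
      [!decide (M (sig M s n ++ [false], s) ≤ M (sig M s n ++ [true], s))]

def fbit (M : List Bool × ℕ → ℚ) (p : ℕ × ℕ) : Bool :=
  !decide (M (sig M p.2 p.1 ++ [false], p.2) ≤ M (sig M p.2 p.1 ++ [true], p.2))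

theorem sig_succ (M : List Bool × ℕ → ℚ) (s n : ℕ) :
    sig M s (n + 1) = sig M s n ++ [fbit M (n, s)] := rfl

def test (O : ℕ → ℕ) (s i : ℕ) : ℕ :=
  Nat.pair (O (Nat.pair (appc false i) s)) (O (Nat.pair (appc true i) s))

theorem test_tot (O : ℕ → ℕ) : Tot O (fun k => test O k.unpair.1 k.unpair.2) := by
  have hO : Tot O O := RecIn.oracle
  have hl : Tot O (fun n => n.unpair.1) := RecIn.left
  have hr : Tot O (fun n => n.unpair.2) := RecIn.right
  exact (hO.comp (((Tot.prim (appc_prim false)).comp hr).pair hl)).pair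
    (hO.comp (((Tot.prim (appc_prim true)).comp hr).pair hl))

def ccode (t : ℕ) : Bool := cmpc t.unpair.1 t.unpair.2

theorem ccode_prim : Primrec ccode :=
  cmpc_prim.comp (Primrec.fst.comp Primrec.unpair) (Primrec.snd.comp Primrec.unpair)

theorem oracle_spec (M : List Bool × ℕ → ℚ) (σ : List Bool) (s : ℕ) :
    fnOracle M (Nat.pair (Encodable.encode σ) s) = Encodable.encode (M (σ, s)) + 1 := by
  have : Nat.pair (Encodable.encode σ) s = Encodable.encode (σ, s) := rfl
  rw [this]
  simp [fnOracle]

theorem test_spec (M : List Bool × ℕ → ℚ) (hpos : ∀ p, 0 ≤ M p) (σ : List Bool) (s : ℕ) :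
    ccode (test (fnOracle M) s (Encodable.encode σ)) =
      decide (M (σ ++ [false], s) ≤ M (σ ++ [true], s)) := by
  unfold ccode test
  rw [appc_spec, appc_spec, oracle_spec, oracle_spec, Nat.unpair_pair]
  exact cmpc_spec _ _ (hpos _) (hpos _)

/-- `k = pair t i` : select extension -/
def selc (k : ℕ) : ℕ := bif ccode k.unpair.1 then appc false k.unpair.2 else appc true k.unpair.2

theorem selc_prim : Primrec selc := by
  have hu1 : Primrec fun n : ℕ => n.unpair.1 := Primrec.fst.comp Primrec.unpair
  have hu2 : Primrec fun n : ℕ => n.unpair.2 := Primrec.snd.comp Primrec.unpair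
  exact Primrec.cond (ccode_prim.comp hu1) ((appc_prim false).comp hu2) ((appc_prim true).comp hu2)

theorem sig_tot (M : List Bool × ℕ → ℚ) (hpos : ∀ p, 0 ≤ M p) :
    Tot (fnOracle M) (fun k => Encodable.encode (sig M k.unpair.1 k.unpair.2)) := by
  have hl : Tot (fnOracle M) (fun n => n.unpair.1) := RecIn.left
  have hr : Tot (fnOracle M) (fun n => n.unpair.2) := RecIn.right
  have hstep : Tot (fnOracle M) (fun m => selc (Nat.pair
      (test (fnOracle M) m.unpair.1 m.unpair.2.unpair.2) m.unpair.2.unpair.2)) := by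
    have h := (test_tot (fnOracle M)).comp (hl.pair (hr.comp hr))
    simp only [Nat.unpair_pair] at h
    exact (Tot.prim selc_prim).comp (h.pair (hr.comp hr))
  have h0 : Tot (fnOracle M) (fun _ => 0) := RecIn.zero
  have h := h0.prec hstep
  refine (congrArg (Tot (fnOracle M)) (funext fun k => ?_)).mpr h
  simp only [Nat.unpaired, Nat.unpair_pair]
  induction k.unpair.2 with
  | zero => rfl
  | succ n ih =>
    simp only [← ih]
    simp only [selc, Nat.unpair_pair, test_spec M hpos, appc_spec, sig]
    cases decide (M (sig M k.unpair.1 n ++ [false], k.unpair.1) ≤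
      M (sig M k.unpair.1 n ++ [true], k.unpair.1)) <;> rfl

theorem fbit_red (M : List Bool × ℕ → ℚ) (hpos : ∀ p, 0 ≤ M p) : FFRed (fbit M) M := by
  have hl : Tot (fnOracle M) (fun n => n.unpair.1) := RecIn.left
  have hr : Tot (fnOracle M) (fun n => n.unpair.2) := RecIn.right
  have h1 := (sig_tot M hpos).comp (hr.pair hl)
  have h2 := (test_tot (fnOracle M)).comp (hr.pair h1)
  have h3 : Primrec (fun t => Encodable.encode (some (!ccode t))) :=
    Primrec.encode.comp (Primrec.option_some.comp (Primrec.not.comp ccode_prim))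
  have h4 := (Tot.prim h3).comp h2
  simp only [Nat.unpair_pair, test_spec M hpos] at h4
  unfold FFRed
  refine (congrArg (Tot (fnOracle M)) (funext fun n => ?_)).mpr h4
  have : (Encodable.decode n : Option (ℕ × ℕ)) = some n.unpair := by
    simp
  simp only [fnOracle, this, Option.map_some, fbit]

theorem sig_stab (M : List Bool × ℕ → ℚ)
    (hlim : ∀ σ, ∃ s₀, ∀ s ≥ s₀, M (σ, s) = M (σ, s₀)) (n : ℕ) :
    ∃ s₀, ∀ s ≥ s₀, sig M s n = sig M s₀ n := by
  induction n with
  | zero => exact ⟨0, fun _ _ => rfl⟩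
  | succ n ih =>
    obtain ⟨a, ha⟩ := ih
    obtain ⟨b, hb⟩ := hlim (sig M a n ++ [false])
    obtain ⟨c, hc⟩ := hlim (sig M a n ++ [true])
    have key : ∀ s ≥ a + b + c, sig M s (n + 1) = sig M a n ++
        [!decide (M (sig M a n ++ [false], b) ≤ M (sig M a n ++ [true], c))] := by
      intro s hs
      simp only [sig]
      rw [ha s (by omega), hb s (by omega), hc s (by omega)]
    exact ⟨a + b + c, fun s hs => by rw [key s hs, key _ le_rfl]⟩

theorem fbit_stab (M : List Bool × ℕ → ℚ)
    (hlim : ∀ σ, ∃ s₀, ∀ s ≥ s₀, M (σ, s) = M (σ, s₀)) (n : ℕ) :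
    ∃ s₀, ∀ s ≥ s₀, fbit M (n, s) = fbit M (n, s₀) := by
  obtain ⟨a, ha⟩ := sig_stab M hlim (n + 1)
  obtain ⟨b, hb⟩ := sig_stab M hlim n
  refine ⟨a + b, fun s hs => ?_⟩
  have h1 := (ha s (by omega)).trans (ha (a + b) (by omega)).symm
  have h2 := (hb s (by omega)).trans (hb (a + b) (by omega)).symm
  rw [sig_succ, sig_succ, h2] at h1
  simpa using h1

theorem sig_seg (M : List Bool × ℕ → ℚ)
    (hlim : ∀ σ, ∃ s₀, ∀ s ≥ s₀, M (σ, s) = M (σ, s₀)) (A : Set ℕ)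
    (hA : ∀ x, x ∈ A ↔ ∃ s₀, ∀ s ≥ s₀, fbit M (x, s) = true) (n : ℕ) :
    ∃ s₀, ∀ s ≥ s₀, sig M s n = seg A n := by
  induction n with
  | zero => exact ⟨0, fun _ _ => rfl⟩
  | succ n ih =>
    obtain ⟨a, ha⟩ := ih
    obtain ⟨b, hb⟩ := fbit_stab M hlim n
    refine ⟨a + b, fun s hs => ?_⟩
    have hseg : seg A (n + 1) = seg A n ++ [if n ∈ A then true else false] := by
      simp [seg, List.range_succ]
    rw [sig_succ, hseg, ha s (by omega), hb s (by omega)]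
    congr 2
    by_cases h : n ∈ A
    · rw [if_pos h]
      obtain ⟨c, hc⟩ := (hA n).1 h
      rw [← hb (b + c) (by omega), hc _ (by omega)]
    · rw [if_neg h]
      by_contra hne
      exact h ((hA n).2 ⟨b, fun s hs => by rw [hb s hs]; simpa using hne⟩)

theorem sig_le (M : List Bool × ℕ → ℚ)
    (havg : ∀ σ s, 2 * M (σ, s) = M (σ ++ [false], s) + M (σ ++ [true], s)) (s n : ℕ) :
    M (sig M s n, s) ≤ M ([], s) := by
  induction n with
  | zero => exact le_rfl
  | succ n ih =>
    refine le_trans ?_ ih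
    have h := havg (sig M s n) s
    simp only [sig]
    by_cases hc : M (sig M s n ++ [false], s) ≤ M (sig M s n ++ [true], s)
    · simp only [hc, decide_true, Bool.not_true]; linarith
    · simp only [hc, decide_false, Bool.not_false]; linarith

/-- from every martingale approximation `M` one can compute a stable
`{0,1}`-valued approximation `f` whose limit set is not succeeded on by the limit
martingale of `M`. -/
theorem stmt11 (M : List Bool × ℕ → ℚ)
    (hpos : ∀ p, 0 ≤ M p)
    (havg : ∀ σ s, 2 * M (σ, s) = M (σ ++ [false], s) + M (σ ++ [true], s))
    (hlim : ∀ σ, ∃ s₀, ∀ s ≥ s₀, M (σ, s) = M (σ, s₀)) :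
    ∃ f : ℕ × ℕ → Bool, FFRed f M ∧
      (∀ x, ∃ s₀, ∀ s ≥ s₀, f (x, s) = f (x, s₀)) ∧
      ∀ (A : Set ℕ) (Mt : List Bool → ℚ),
        (∀ x, x ∈ A ↔ ∃ s₀, ∀ s ≥ s₀, f (x, s) = true) →
        (∀ σ, ∃ s₀, ∀ s ≥ s₀, M (σ, s) = Mt σ) →
        ¬ Succeeds Mt A := by
  refine ⟨fbit M, fbit_red M hpos, fbit_stab M hlim, ?_⟩
  intro A Mt hA hMt hS
  obtain ⟨n, hn⟩ := hS (Mt [])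
  obtain ⟨a, ha⟩ := sig_seg M hlim A hA n
  obtain ⟨b, hb⟩ := hMt (seg A n)
  obtain ⟨c, hc⟩ := hMt []
  have h := sig_le M havg (a + b + c) n
  rw [ha _ (by omega), hb _ (by omega), hc _ (by omega)] at h
  exact absurd hn (not_lt.mpr h)
end
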